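/- Let (m_0, m_1, ..., m_ℓ) be nonnegative integers summing to n. Then in the ring of symmetric functions, s_{(m_0)} · Π_{r=1}^{ℓ} Σ_{i=0}^{2m_r} (−1)^i s_{(i)} s_{(2m_r − i)} = Σ_{λ ⊢ 2n − m_0} (−1)^{n(λ)} |D^λ_{(m_0, m_1, ..., m_ℓ)}| s_λ, where |D^λ_{(m_0,...,m_ℓ)}| is the number of domino tableaux of shape λ/(m_0) and weight (m_0, m_1, ..., m_ℓ). -/

import Mathlib

/-!
Common framework for a formalization of statements from
"Gelfand–Graev characters of the finite unitary groups" (Thiem–Vinroot).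
-/

open scoped Classical

noncomputable section

namespace GGU

/-! ### Partitions -/

/-- A partition, encoded as a weakly decreasing, finitely supported sequence of
natural numbers; `parts i` is the `i`-th part `λ_i` for `i ≥ 1`, and `parts 0 = 0`
by convention. -/
structure Partn where
  parts : ℕ → ℕ
  parts_zero : parts 0 = 0
  parts_antitone : ∀ ⦃i j : ℕ⦄, 1 ≤ i → i ≤ j → parts j ≤ parts i
  parts_finite : {i : ℕ | parts i ≠ 0}.Finite

/-- The size `|λ|` of a partition. -/
def Partn.size (l : Partn) : ℕ := ∑ᶠ i, l.parts i

/-- The length `ℓ(λ)` (number of nonzero parts) of a partition. -/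
def Partn.len (l : Partn) : ℕ := {i : ℕ | l.parts i ≠ 0}.ncard

/-- The statistic `n(λ) = ∑ (i-1)·λ_i`. -/
def Partn.nstat (l : Partn) : ℕ := ∑ᶠ i, (i - 1) * l.parts i

/-- The multiplicity `m_k(λ)` of the part `k ≥ 1` in `λ`. -/
def Partn.mult (l : Partn) (k : ℕ) : ℕ := {i : ℕ | 1 ≤ i ∧ l.parts i = k}.ncard

/-- `z_λ = ∏_k k^{m_k} m_k!`. -/
def Partn.zee (l : Partn) : ℕ := ∏ᶠ k, k ^ l.mult k * (l.mult k).factorial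

/-- The cell `(i,j)` (row `i ≥ 1`, column `j ≥ 1`) lies in the Young diagram of `λ`. -/
def Partn.cell (l : Partn) (c : ℕ × ℕ) : Prop := 1 ≤ c.1 ∧ 1 ≤ c.2 ∧ c.2 ≤ l.parts c.1

/-- The empty partition. -/
def Partn.empty : Partn where
  parts := fun _ => 0
  parts_zero := rfl
  parts_antitone := fun _ _ _ _ => le_rfl
  parts_finite := by simp

/-- The one-row partition `(m)`. -/
def Partn.ofRow (m : ℕ) : Partn where
  parts := fun i => if i = 1 then m else 0
  parts_zero := by simp
  parts_antitone := by
    intro i j hi hij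
    by_cases hj : j = 1
    · have hi1 : i = 1 := by omega
      simp [hj, hi1]
    · simp [hj]
  parts_finite := Set.Finite.subset (Set.finite_singleton 1) (by
    intro i hi
    by_cases h : i = 1 <;> simp_all)

/-- Partial sums `λ_1 + ⋯ + λ_k`. -/
def Partn.cumul (l : Partn) (k : ℕ) : ℕ := ∑ t ∈ Finset.range k, l.parts (t + 1)

/-- Strict dominance order on partitions of the same size. -/
def DomLt (l m : Partn) : Prop :=
  l.size = m.size ∧ l ≠ m ∧ ∀ k, l.cumul k ≤ m.cumul k

/-- The set `{ν_{≤ 1}, ν_{≤ 2}, …}` of partial sums of a partition `ν`. -/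
def cumSet (nu : Partn) : Set ℕ := {m : ℕ | ∃ j, 1 ≤ j ∧ m = nu.cumul j}

/-- Lexicographic order on weight sequences. -/
def LexLE (f g : ℕ → ℕ) : Prop := f = g ∨ ∃ k, f k < g k ∧ ∀ j < k, f j = g j

/-! ### Dominoes, 2-cores and 2-quotients -/

/-- Two cells are adjacent (horizontally or vertically). -/
def adjCell (c d : ℕ × ℕ) : Prop :=
  (c.1 = d.1 ∧ (c.2 + 1 = d.2 ∨ d.2 + 1 = c.2)) ∨
  (c.2 = d.2 ∧ (c.1 + 1 = d.1 ∨ d.1 + 1 = c.1))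

/-- `DomStep μ ρ` : the partition `ρ` is obtained from `μ` by removing one domino. -/
def DomStep (mu rho : Partn) : Prop :=
  (∀ i, rho.parts i ≤ mu.parts i) ∧
  ∃ c d : ℕ × ℕ, c ≠ d ∧ adjCell c d ∧
    mu.cell c ∧ mu.cell d ∧ ¬ rho.cell c ∧ ¬ rho.cell d ∧
    ∀ e : ℕ × ℕ, mu.cell e → ¬ rho.cell e → e = c ∨ e = d

/-- `γ` is the 2-core of `λ`: it is obtained from `λ` by successively removing
dominoes, and admits no further domino removal. -/
def TwoCore (lam gam : Partn) : Prop :=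
  Relation.ReflTransGen DomStep lam gam ∧ ∀ rho, ¬ DomStep gam rho

/-- `core₂(λ) ∈ {∅, (1)}`. -/
def core2small (lam : Partn) : Prop := ∃ gam, TwoCore lam gam ∧ gam.size ≤ 1

/-- The size `|core₂(λ)|` of the 2-core of `λ`. -/
def core2size (lam : Partn) : ℕ := sInf {s | ∃ gam, TwoCore lam gam ∧ gam.size = s}

/-- The `j`-th part of one member (`ε ∈ {0,1}`) of the 2-quotient of `λ`,
computed from the β-set `{λ_t + N - t : 1 ≤ t ≤ N}` with `N = 2(|λ|+1)`. -/
def quot2part (lam : Partn) (ε : ℕ) (j : ℕ) : ℕ :=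
  let N := 2 * (lam.size + 1)
  let B := (Finset.range N).image fun t => lam.parts (t + 1) + (N - (t + 1))
  let L := (B.filter fun b => b % 2 = ε).sort (· ≤ ·)
  if 1 ≤ j ∧ j ≤ L.length then (L.getD (L.length - j) 0) / 2 - (L.length - j) else 0

/-- `quot₂(λ)_j`, the sum of the `j`-th parts of the two members of the 2-quotient. -/
def quot2sum (lam : Partn) (j : ℕ) : ℕ := quot2part lam 0 j + quot2part lam 1 j

/-! ### Tableaux -/

/-- A semistandard (column-strict) Young tableau of shape `λ` with entries in `{1,2,…}`. -/
structure SSYT (lam : Partn) where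
  entry : ℕ × ℕ → ℕ
  entry_pos : ∀ c, lam.cell c → 1 ≤ entry c
  entry_outside : ∀ c, ¬ lam.cell c → entry c = 0
  row_weak : ∀ i j : ℕ, lam.cell (i, j + 1) → entry (i, j) ≤ entry (i, j + 1)
  col_strict : ∀ i j : ℕ, 1 ≤ i → lam.cell (i + 1, j) → entry (i, j) < entry (i + 1, j)

/-- The number of entries equal to `k` in a semistandard tableau. -/
def SSYT.wt {lam : Partn} (T : SSYT lam) (k : ℕ) : ℕ :=
  {c : ℕ × ℕ | lam.cell c ∧ T.entry c = k}.ncard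

/-- A symplectic tableau: a column strict filling of `λ` by the symbols
`0 < 1̄ < 1 < 2̄ < 2 < ⋯`, where the symbol `0` is encoded by `0`, `k̄` by `2k-1`
and `k` by `2k`. -/
structure SympTab (lam : Partn) where
  entry : ℕ × ℕ → ℕ
  entry_outside : ∀ c, ¬ lam.cell c → entry c = 0
  row_weak : ∀ i j : ℕ, lam.cell (i, j + 1) → entry (i, j) ≤ entry (i, j + 1)
  col_strict : ∀ i j : ℕ, 1 ≤ i → lam.cell (i + 1, j) → entry (i, j) < entry (i + 1, j)

/-- The weight of a symplectic tableau: `wt 0` is the number of `0`'s, and for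
`k ≥ 1`, `wt k` is the number of `k̄`'s plus the number of `k`'s. -/
def SympTab.wt {lam : Partn} (T : SympTab lam) (k : ℕ) : ℕ :=
  if k = 0 then {c : ℕ × ℕ | lam.cell c ∧ T.entry c = 0}.ncard
  else {c : ℕ × ℕ | lam.cell c ∧ (T.entry c = 2 * k - 1 ∨ T.entry c = 2 * k)}.ncard

/-- The cells of `λ/(m₀)`: cells of `λ` other than the `m₀` leftmost cells of the
first row. -/
def Partn.tiled (lam : Partn) (m0 : ℕ) (c : ℕ × ℕ) : Prop :=
  lam.cell c ∧ ¬ (c.1 = 1 ∧ c.2 ≤ m0)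

/-- A (semistandard) domino tableau of shape `λ/(m₀)`: a column strict filling of a
tiling of `λ/(m₀)` by dominoes, with `0`'s in the `m₀` non-tiled boxes.  The tiling is
recorded by the involution `mate` matching each tiled cell with the other cell of its
domino. -/
structure DomTab (lam : Partn) (m0 : ℕ) where
  m0_le : m0 ≤ lam.parts 1
  entry : ℕ × ℕ → ℕ
  mate : ℕ × ℕ → ℕ × ℕ
  entry_pos : ∀ c, lam.tiled m0 c → 1 ≤ entry c
  entry_zero : ∀ c, ¬ lam.tiled m0 c → entry c = 0
  mate_tiled : ∀ c, lam.tiled m0 c → lam.tiled m0 (mate c)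
  mate_id : ∀ c, ¬ lam.tiled m0 c → mate c = c
  mate_invol : ∀ c, mate (mate c) = c
  mate_adj : ∀ c, lam.tiled m0 c → adjCell c (mate c)
  mate_entry : ∀ c, entry (mate c) = entry c
  row_weak : ∀ i j : ℕ, lam.cell (i, j + 1) → entry (i, j) ≤ entry (i, j + 1)
  col_strict : ∀ i j : ℕ, 1 ≤ i → lam.cell (i + 1, j) → mate (i, j) ≠ (i + 1, j) →
    entry (i, j) < entry (i + 1, j)

/-- The weight of a domino tableau: `wt k` is the number of dominoes labelled `k`. -/
def DomTab.wt {lam : Partn} {m0 : ℕ} (T : DomTab lam m0) (k : ℕ) : ℕ :=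
  {c : ℕ × ℕ | lam.tiled m0 c ∧ T.entry c = k}.ncard / 2

/-! ### Θ-partitions and battery tableaux -/

/-- A `Θ`-partition: an assignment of a partition to each element of the index
type `Th` (the set of Frobenius orbits), with finite support. -/
structure TPartn (Th : Type) where
  lam : Th → Partn
  finite : {φ : Th | lam φ ≠ Partn.empty}.Finite

/-- The size `|λ| = ∑_φ |φ|·|λ^{(φ)}|` of a `Θ`-partition, where `deg φ` is the
orbit size `|φ|`. -/
def TPartn.size {Th : Type} (deg : Th → ℕ) (l : TPartn Th) : ℕ :=
  ∑ᶠ φ, deg φ * (l.lam φ).size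

/-- `n(λ) = ∑_φ |φ|·n(λ^{(φ)})` for a `Θ`-partition. -/
def TPartn.nstat {Th : Type} (deg : Th → ℕ) (l : TPartn Th) : ℕ :=
  ∑ᶠ φ, deg φ * (l.lam φ).nstat

/-- A battery `Θ`-tableau of shape `λ/γ` (with `hgt(γ) ≤ 1`, so that `γ^{(φ)}` is the
one-row partition `(γ^{(φ)}_1)`): a domino tableau of shape `λ^{(φ)}/(γ^{(φ)}_1)` for each
`φ` with `|φ|` odd, and a symplectic tableau of shape `λ^{(φ)}/(γ^{(φ)}_1)` for each `φ`
with `|φ|` even. -/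
structure BatteryTab {Th : Type} (deg : Th → ℕ) (lam gam : Th → Partn) where
  dom : ∀ φ, Odd (deg φ) → DomTab (lam φ) ((gam φ).parts 1)
  symp : ∀ φ, ¬ Odd (deg φ) → SympTab (lam φ)
  symp_wt0 : ∀ φ (h : ¬ Odd (deg φ)), (symp φ h).wt 0 = (gam φ).parts 1

/-- The weight of a battery tableau:
`wt(Q)_i = ∑_{|φ| odd} |φ|·wt(Q^{(φ)})_i + ∑_{|φ| even} (|φ|/2)·wt(Q^{(φ)})_i`. -/
def BatteryTab.wt {Th : Type} {deg : Th → ℕ} {lam gam : Th → Partn}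
    (T : BatteryTab deg lam gam) (i : ℕ) : ℕ :=
  ∑ᶠ φ : Th, if h : Odd (deg φ) then deg φ * (T.dom φ h).wt i
    else (deg φ / 2) * (T.symp φ h).wt i

/-- The set `B^λ_{(k,ν)}` of battery tableaux of shape `λ/γ`, for some `Θ`-partition
`γ` of size `k` with `hgt(γ) ≤ 1`, and of weight `ν`. -/
structure Battery {Th : Type} (deg : Th → ℕ) (lam : TPartn Th) (k : ℕ) (nu : Partn) where
  gam : TPartn Th
  gam_size : TPartn.size deg gam = k
  gam_hgt : ∀ φ, (gam.lam φ).len ≤ 1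
  gam_le : ∀ φ, (gam.lam φ).parts 1 ≤ (lam.lam φ).parts 1
  tab : BatteryTab deg lam.lam gam.lam
  tab_wt : ∀ i, 1 ≤ i → tab.wt i = nu.parts i

/-! ### Symmetric functions as formal power series -/

/-- The Schur function `s_λ` in the variables `X_0, X_1, X_2, …`, defined
combinatorially: the coefficient of a monomial is the number of semistandard Young
tableaux of shape `λ` with the corresponding content. -/
def sSchur (lam : Partn) : MvPowerSeries ℕ ℂ :=
  fun d => (Nat.card {T : SSYT lam // ∀ k, 1 ≤ k → T.wt k = d (k - 1)} : ℂ)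

/-- The Schur function `s_λ(Y^{(φ)})` in the variable family `Y^{(φ)}`, inside the ring
of symmetric functions in the variables `{Y^{(φ)}_j : φ ∈ Θ, j ∈ ℕ}`. -/
def sSchurAt {Th : Type} (φ : Th) (lam : Partn) : MvPowerSeries (Th × ℕ) ℂ :=
  fun d => if ∀ x ∈ d.support, x.1 = φ then
    (Nat.card {T : SSYT lam // ∀ k, 1 ≤ k → T.wt k = d (φ, k - 1)} : ℂ) else 0

/-- `s_λ = ∏_φ s_{λ^{(φ)}}(Y^{(φ)})` for a `Θ`-partition `λ`. -/
def sTheta {Th : Type} (l : TPartn Th) : MvPowerSeries (Th × ℕ) ℂ :=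
  ∏ᶠ φ, sSchurAt φ (l.lam φ)

/-- The monomial symmetric function `m_λ`. -/
def msym (l : Partn) : MvPowerSeries ℕ ℂ :=
  fun d => if d.support.val.map (fun i => d i) = l.parts_finite.toFinset.val.map l.parts
    then 1 else 0

/-- The power sum `p_k = ∑_i X_i^k` (with `p_0 = 1` by convention). -/
def ppow (k : ℕ) : MvPowerSeries ℕ ℂ :=
  if k = 0 then 1
  else fun d => if ∃ i : ℕ, d = Finsupp.single i k then 1 else 0

/-- The power sum symmetric function `p_ν = p_{ν_1} p_{ν_2} ⋯`. -/
def psym (l : Partn) : MvPowerSeries ℕ ℂ := ∏ᶠ i, ppow (l.parts i)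

/-- Plethysm with the power sum `p_2`: `(f ∘ p_2)(X_0, X_1, …) = f(X_0^2, X_1^2, …)`. -/
def plet2 (F : MvPowerSeries ℕ ℂ) : MvPowerSeries ℕ ℂ :=
  fun d => if ∀ i, 2 ∣ d i
    then F (Finsupp.mapRange (· / 2) (Nat.zero_div 2) d) else 0



/-! ### The finite groups: `GL(n, F_{p^r})` and `U(n, F_{q²})` inside `GL(n, F̄_p)` -/

/-- An algebraic closure `F̄_p` of the prime field. -/
abbrev Fbar (p : ℕ) [Fact p.Prime] : Type := AlgebraicClosure (ZMod p)

/-- The field endomorphism `x ↦ x^{p^r}` of `F̄_p`. -/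
def frobPow (p : ℕ) [Fact p.Prime] (r : ℕ) : Fbar p →+* Fbar p :=
  haveI : CharP (Fbar p) p :=
    charP_of_injective_algebraMap (algebraMap (ZMod p) (Fbar p)).injective p
  haveI : ExpChar (Fbar p) p := ExpChar.prime Fact.out
  iterateFrobenius (Fbar p) p r

/-- The entrywise Frobenius `(a_{ij}) ↦ (a_{ij}^{p^r})` on `GL(n, F̄_p)`. -/
def entryFrobGL (p : ℕ) [Fact p.Prime] (r n : ℕ) :
    (Matrix (Fin n) (Fin n) (Fbar p))ˣ →* (Matrix (Fin n) (Fin n) (Fbar p))ˣ :=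
  Units.map ((frobPow p r).mapMatrix.toMonoidHom)

/-- `GL(n, F_{p^r})`, realized as the fixed points of the entrywise Frobenius
`(a_{ij}) ↦ (a_{ij}^{p^r})` on `GL(n, F̄_p)`. -/
def GLfix (p : ℕ) [Fact p.Prime] (r n : ℕ) : Subgroup (Matrix (Fin n) (Fin n) (Fbar p))ˣ where
  carrier := {A | entryFrobGL p r n A = A}
  one_mem' := by simp
  mul_mem' := by
    intro a b ha hb
    simp only [Set.mem_setOf_eq, map_mul] at *
    rw [ha, hb]
  inv_mem' := by
    intro a ha
    simp only [Set.mem_setOf_eq, map_inv] at *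
    rw [ha]

/-- The anti-transpose `(M^{at})_{ij} = M_{n+1-j, n+1-i}` of a matrix. -/
def atrans {n : ℕ} {K : Type*} (M : Matrix (Fin n) (Fin n) K) : Matrix (Fin n) (Fin n) K :=
  Matrix.of fun i j => M (Fin.rev j) (Fin.rev i)

lemma atrans_one {n : ℕ} {K : Type*} [NonAssocSemiring K] :
    atrans (1 : Matrix (Fin n) (Fin n) K) = 1 := by
  ext i j
  simp only [atrans, Matrix.of_apply, Matrix.one_apply, Fin.rev_inj]
  by_cases h : i = j
  · simp [h]
  · simp [h, Ne.symm h]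

lemma atrans_mul {n : ℕ} {K : Type*} [CommSemiring K] (M N : Matrix (Fin n) (Fin n) K) :
    atrans (M * N) = atrans N * atrans M := by
  ext i j
  simp only [atrans, Matrix.of_apply, Matrix.mul_apply]
  exact Fintype.sum_equiv Fin.revPerm _ _ (fun k => by
    simp [Fin.rev_rev, mul_comm])

/-- The twisted Frobenius `F'(A) = (ᵃ(A^{p^f}))⁻¹` (entrywise `q = p^f` power, followed by
anti-transpose-inverse) on `GL(n, F̄_p)`, whose fixed point group is the finite unitary
group `U(n, F_{q²})`. -/
def unitaryFrob (p : ℕ) [Fact p.Prime] (fexp n : ℕ) :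
    (Matrix (Fin n) (Fin n) (Fbar p))ˣ →* (Matrix (Fin n) (Fin n) (Fbar p))ˣ where
  toFun A :=
    { val := atrans ((frobPow p fexp).mapMatrix A.inv)
      inv := atrans ((frobPow p fexp).mapMatrix A.val)
      val_inv := by
        rw [← atrans_mul, ← map_mul, A.val_inv, map_one, atrans_one]
      inv_val := by
        rw [← atrans_mul, ← map_mul, A.inv_val, map_one, atrans_one] }
  map_one' := by
    apply Units.ext
    show atrans ((frobPow p fexp).mapMatrix (1 : Matrix (Fin n) (Fin n) (Fbar p))) = _
    rw [map_one, atrans_one]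
    rfl
  map_mul' := by
    intro A B
    apply Units.ext
    show atrans ((frobPow p fexp).mapMatrix (B.inv * A.inv)) = _
    rw [map_mul, atrans_mul]
    rfl

/-- The finite unitary group `U(n, F_{q²})` (with `q = p^fexp`), realized as the fixed
points of the twisted Frobenius `F'` on `GL(n, F̄_p)`. -/
def Uprime (p : ℕ) [Fact p.Prime] (fexp n : ℕ) :
    Subgroup (Matrix (Fin n) (Fin n) (Fbar p))ˣ where
  carrier := {A | unitaryFrob p fexp n A = A}
  one_mem' := by simp
  mul_mem' := by
    intro a b ha hb
    simp only [Set.mem_setOf_eq, map_mul] at *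
    rw [ha, hb]
  inv_mem' := by
    intro a ha
    simp only [Set.mem_setOf_eq, map_inv] at *
    rw [ha]

/-- The underlying matrix of an element of a subgroup of `GL(n, F̄_p)`. -/
def matOf {p : ℕ} [Fact p.Prime] {n : ℕ} {H : Subgroup (Matrix (Fin n) (Fin n) (Fbar p))ˣ}
    (u : ↥H) : Matrix (Fin n) (Fin n) (Fbar p) :=
  ((u : (Matrix (Fin n) (Fin n) (Fbar p))ˣ) : Matrix (Fin n) (Fin n) (Fbar p))

/-- The subgroup (as a subset) of unipotent upper-triangular matrices in `H`. -/
def unitri {p : ℕ} [Fact p.Prime] {n : ℕ} (H : Subgroup (Matrix (Fin n) (Fin n) (Fbar p))ˣ) :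
    Set ↥H :=
  {u | (∀ i j : Fin n, j < i → matOf u i j = 0) ∧ ∀ i : Fin n, matOf u i i = 1}

/-! ### Class function machinery -/

/-- The induced class function `Ind_B^G ψ (g) = |B|⁻¹ ∑_{x ∈ G, x⁻¹gx ∈ B} ψ(x⁻¹gx)`,
for a subset `B` of `G` and `ψ : G → ℂ` (only the values of `ψ` on `B` matter). -/
def indChar {G : Type} [Group G] (B : Set G) (ψ : G → ℂ) : G → ℂ :=
  fun g => (Nat.card B : ℂ)⁻¹ * ∑ᶠ x : G, if x⁻¹ * g * x ∈ B then ψ (x⁻¹ * g * x) else 0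

/-- The inner product `⟨f, h⟩ = |G|⁻¹ ∑_g f(g) \overline{h(g)}` of complex class
functions on a finite group. -/
def charInner {G : Type} (f h : G → ℂ) : ℂ :=
  (Nat.card G : ℂ)⁻¹ * ∑ᶠ g : G, f g * (starRingEnd ℂ) (h g)

/-- `θ : G → ℂ` is the character of an irreducible (complex) representation of `G`. -/
def IsIrredChar (G : Type) [Group G] (θ : G → ℂ) : Prop :=
  ∃ V : FDRep ℂ G, CategoryTheory.Simple V ∧ θ = fun g => V.character g

/-- `M` is a unipotent matrix whose Jordan type is the partition `μ`, expressed through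
the ranks of the powers of `M - 1`:  `rank((M-1)^k) = ∑_i max(μ_i - k, 0)` for all `k`. -/
def unipOfType {n : ℕ} {K : Type*} [Field K] (M : Matrix (Fin n) (Fin n) K)
    (mu : Partn) : Prop :=
  ∀ k : ℕ, ((M - 1) ^ k).rank = ∑ᶠ i, (mu.parts i - k)

/-! ### Gelfand–Graev and degenerate Gelfand–Graev characters -/

/-- The sum of the superdiagonal entries `u_{i,i+1}`, `1 ≤ i ≤ ⌊n/2⌋`, `i ∉ S`,
of an element of the unitary group (in the `F'`-fixed, upper-triangular realization). -/
def sdSumU (p : ℕ) [Fact p.Prime] (fexp n : ℕ) (S : Set ℕ)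
    (u : ↥(Uprime p fexp n)) : Fbar p :=
  ∑ i : Fin n, ∑ j : Fin n,
    if (j : ℕ) = (i : ℕ) + 1 ∧ (j : ℕ) ≤ n / 2 ∧ (j : ℕ) ∉ S then matOf u i j else 0

/-- The degenerate Gelfand–Graev character `Γ_{(k,ν)}` of `U(n, F_{q²})` (it depends only
on `ν`; `k = n - 2|ν|`).  It is induced from the linear character
`u ↦ ψ₀(∑_{i ≤ ⌊n/2⌋, i ∉ ν_≤} u_{i,i+1})` of the unipotent upper-triangular subgroup,
where `ν_≤` is the set of partial sums of `ν`.  Taking `ν = ∅` gives the Gelfand–Graev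
character `Γ_{(n)}`. -/
def GammaDGG (p : ℕ) [Fact p.Prime] (fexp n : ℕ) (ψ0 : Fbar p → ℂ) (nu : Partn) :
    ↥(Uprime p fexp n) → ℂ :=
  indChar (unitri (Uprime p fexp n)) (fun u => ψ0 (sdSumU p fexp n (cumSet nu) u))

/-- The sum of all superdiagonal entries of an element of `GL(n, F_{p^r})`. -/
def sdSumGL (p : ℕ) [Fact p.Prime] (r n : ℕ) (u : ↥(GLfix p r n)) : Fbar p :=
  ∑ i : Fin n, ∑ j : Fin n, if (j : ℕ) = (i : ℕ) + 1 then matOf u i j else 0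

/-- The Gelfand–Graev character of `GL(n, F_{p^r})`, induced from the generic linear
character `u ↦ ψ₀(u_{1,2} + u_{2,3} + ⋯ + u_{n-1,n})` of the unipotent upper-triangular
subgroup. -/
def GammaGL (p : ℕ) [Fact p.Prime] (r n : ℕ) (ψ0 : Fbar p → ℂ) : ↥(GLfix p r n) → ℂ :=
  indChar (unitri (GLfix p r n)) (fun u => ψ0 (sdSumGL p r n u))

/-! ### Harish-Chandra induction from `GL(n, F_{q²})` to `U(2n, F_{q²})` -/

/-- The (maximally split) parabolic subgroup of `U(2n, F_{q²})` with Levi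
`GL(n, F_{q²})`: block upper-triangular matrices. -/
def PsetGLU (p : ℕ) [Fact p.Prime] (fexp n : ℕ) : Set ↥(Uprime p fexp (2 * n)) :=
  {g | ∀ i j : Fin (2 * n), (j : ℕ) < n → n ≤ (i : ℕ) → matOf g i j = 0}

/-- Harish-Chandra induction `R_{GL(n,F_{q²})}^{U(2n,F_{q²})}` of a class function `θ` of
`GL(n, F_{q²})`: inflate `θ` to the parabolic `P` through the Levi projection (upper-left
`n × n` block) and induce to `U(2n, F_{q²})`. -/
def HCIndGLtoU (p : ℕ) [Fact p.Prime] (fexp n : ℕ)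
    (θ : ↥(GLfix p (2 * fexp) n) → ℂ) : ↥(Uprime p fexp (2 * n)) → ℂ :=
  fun g =>
    (Nat.card (PsetGLU p fexp n) : ℂ)⁻¹ *
      ∑ᶠ x : ↥(Uprime p fexp (2 * n)), ∑ᶠ l : ↥(GLfix p (2 * fexp) n),
        if x⁻¹ * g * x ∈ PsetGLU p fexp n ∧
            (∀ i j : Fin n,
              matOf (x⁻¹ * g * x) (Fin.castLE (by omega) i) (Fin.castLE (by omega) j) =
                matOf l i j)
        then θ l else 0


lemma Partn.ext' {l m : Partn} (h : ∀ i, 1 ≤ i → l.parts i = m.parts i) : l = m := by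
  have : l.parts = m.parts := by
    funext i
    rcases Nat.eq_zero_or_pos i with rfl | hi
    · rw [l.parts_zero, m.parts_zero]
    · exact h i hi
  cases l; cases m; simp_all

lemma Partn.exists_bound (l : Partn) : ∃ L, ∀ i, L < i → l.parts i = 0 := by
  obtain ⟨L, hL⟩ := l.parts_finite.bddAbove
  refine ⟨L, fun i hi => ?_⟩
  by_contra h
  exact absurd (hL h) (by omega)

lemma Partn.size_eq (l : Partn) (L : ℕ) (h : ∀ i, L < i → l.parts i = 0) :
    l.size = ∑ i ∈ Finset.range L, l.parts (i + 1) := by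
  unfold Partn.size
  rw [finsum_eq_sum_of_support_subset (s := Finset.range (L + 1))]
  · rw [Finset.sum_range_succ', l.parts_zero, add_zero]
  · intro i hi
    simp only [Function.mem_support] at hi
    simp only [Finset.coe_range, Set.mem_Iio]
    by_contra hc
    exact hi (h i (by omega))

lemma Partn.nstat_eq (l : Partn) (L : ℕ) (h : ∀ i, L < i → l.parts i = 0) :
    l.nstat = ∑ i ∈ Finset.range L, i * l.parts (i + 1) := by
  unfold Partn.nstat
  rw [finsum_eq_sum_of_support_subset (s := Finset.range (L + 1))]
  · rw [Finset.sum_range_succ', l.parts_zero, mul_zero, add_zero]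
    simp
  · intro i hi
    simp only [Function.mem_support] at hi
    simp only [Finset.coe_range, Set.mem_Iio]
    by_contra hc
    exact hi (by rw [h i (by omega), mul_zero])

lemma Partn.parts_le_size (l : Partn) (i : ℕ) : l.parts i ≤ l.size := by
  obtain ⟨L, hL⟩ := l.exists_bound
  rcases Nat.eq_zero_or_pos i with rfl | hi
  · rw [l.parts_zero]; omega
  by_cases h : L < i
  · rw [hL i h]; omega
  rw [l.size_eq L hL]
  have := Finset.single_le_sum (f := fun i => l.parts (i + 1)) (s := Finset.range L)
    (fun _ _ => Nat.zero_le _) (a := i - 1) (by simp; omega)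
  simpa [Nat.sub_add_cancel hi] using this

lemma Partn.parts_eq_zero (l : Partn) (i : ℕ) (hi : l.size < i) : l.parts i = 0 := by
  by_contra h
  obtain ⟨L, hL⟩ := l.exists_bound
  have hiL : i ≤ L := by
    by_contra hc
    exact h (hL i (by omega))
  have h1 : ∑ t ∈ Finset.range i, 1 ≤ ∑ t ∈ Finset.range i, l.parts (t + 1) := by
    apply Finset.sum_le_sum
    intro t ht
    have := l.parts_antitone (i := t + 1) (j := i) (by omega) (by simp at ht; omega)
    omega
  have h2 : ∑ t ∈ Finset.range i, l.parts (t + 1) ≤ ∑ t ∈ Finset.range L, l.parts (t + 1) :=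
    Finset.sum_le_sum_of_subset (by intro x; simp; omega)
  rw [← l.size_eq L hL] at h2
  simp at h1
  omega

lemma finite_size_le (n : ℕ) : {l : Partn | l.size ≤ n}.Finite := by
  apply Set.Finite.of_finite_image (f := fun l (i : Fin (n + 1)) => Fin.ofNat (n+1) (l.parts i))
  · exact Set.toFinite _
  · intro l hl m hm h
    simp only [Set.mem_ofPred_eq] at hl hm
    apply Partn.ext'
    intro i hi
    by_cases hin : n < i
    · rw [l.parts_eq_zero i (by omega), m.parts_eq_zero i (by omega)]
    · have := congrFun h ⟨i, by omega⟩
      have h1 := l.parts_le_size i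
      have h2 := m.parts_le_size i
      simp only [Fin.ext_iff, Fin.val_ofNat] at this
      rwa [Nat.mod_eq_of_lt (by omega), Nat.mod_eq_of_lt (by omega)] at this

/-- partitions of size at most `n` -/
def bF (n : ℕ) : Finset Partn := (finite_size_le n).toFinset

lemma mem_bF {n : ℕ} {l : Partn} : l ∈ bF n ↔ l.size ≤ n := by simp [bF]

/-- build a partition from a zero-indexed antitone sequence -/
def Partn.ofFun (p : ℕ → ℕ) (hp : ∀ i, p (i + 1) ≤ p i) (hf : ∃ L, ∀ i, L ≤ i → p i = 0) : Partn where
  parts := fun i => if i = 0 then 0 else p (i - 1)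
  parts_zero := by simp
  parts_antitone := by
    intro i j hi hij
    rw [if_neg (by omega), if_neg (by omega)]
    exact antitone_nat_of_succ_le hp (by omega)
  parts_finite := by
    obtain ⟨L, hL⟩ := hf
    apply Set.Finite.subset (Set.finite_le_nat L)
    intro i hi
    simp only [Set.mem_ofPred_eq] at hi ⊢
    by_contra hc
    apply hi
    rw [if_neg (by omega), hL _ (by omega)]

@[simp] lemma Partn.ofFun_parts (p : ℕ → ℕ) (hp hf) (i : ℕ) :
    (Partn.ofFun p hp hf).parts (i + 1) = p i := by simp [Partn.ofFun]

lemma Partn.size_mono {l m : Partn} (h : ∀ i, 1 ≤ i → l.parts i ≤ m.parts i) : l.size ≤ m.size := by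
  obtain ⟨L, hL⟩ := m.exists_bound
  rw [m.size_eq L hL, l.size_eq L (fun i hi => by have := h i (by omega); have := hL i hi; omega)]
  exact Finset.sum_le_sum fun i _ => h _ (by omega)

/-- horizontal strip relation -/
def HS (mu lam : Partn) : Prop := ∀ i, mu.parts (i+1) ≤ lam.parts (i+1) ∧ lam.parts (i + 2) ≤ mu.parts (i+1)

lemma HS.size_le {mu lam : Partn} (h : HS mu lam) : mu.size ≤ lam.size :=
  Partn.size_mono fun i hi => by
    have := (h (i-1)).1
    rwa [Nat.sub_add_cancel hi] at this

def dnF (lam : Partn) : Finset Partn := (bF lam.size).filter (fun mu => HS mu lam)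
lemma mem_dnF {lam mu : Partn} : mu ∈ dnF lam ↔ HS mu lam := by
  simp only [dnF, Finset.mem_filter, mem_bF]
  exact ⟨fun h => h.2, fun h => ⟨h.size_le, h⟩⟩
def upF (mu : Partn) (m : ℕ) : Finset Partn :=
  (bF (mu.size + m)).filter (fun lam => HS mu lam ∧ lam.size = mu.size + m)
lemma mem_upF {lam mu : Partn} {m : ℕ} : lam ∈ upF mu m ↔ HS mu lam ∧ lam.size = mu.size + m := by
  simp only [upF, Finset.mem_filter, mem_bF]
  exact ⟨fun h => h.2, fun h => ⟨h.2.le, h⟩⟩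

lemma size_ofRow (m : ℕ) : (Partn.ofRow m).size = m := by
  rw [Partn.size_eq _ 1]
  · simp [Partn.ofRow]
  · intro i hi
    simp [Partn.ofRow]; omega
lemma size_empty : Partn.empty.size = 0 := by
  rw [Partn.size_eq _ 0 (by simp [Partn.empty])]; simp
lemma size_eq_zero {l : Partn} (h : l.size = 0) : l = Partn.empty :=
  Partn.ext' fun i hi => by
    have := l.parts_le_size i
    simp [Partn.empty]; omega
lemma ofRow_zero : Partn.ofRow 0 = Partn.empty := size_eq_zero (size_ofRow 0)
lemma ofRow_inj {a b : ℕ} (h : Partn.ofRow a = Partn.ofRow b) : a = b := by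
  rw [← size_ofRow a, h, size_ofRow]

lemma HS_ofRow {mu : Partn} {m : ℕ} : HS mu (Partn.ofRow m) ↔ ∃ k ≤ m, mu = Partn.ofRow k := by
  constructor
  · intro h
    refine ⟨mu.parts 1, by simpa [Partn.ofRow] using (h 0).1, Partn.ext' fun i hi => ?_⟩
    by_cases hi1 : i = 1
    · simp [Partn.ofRow, hi1]
    · have := (h (i-1)).1
      rw [Nat.sub_add_cancel hi] at this
      simpa [Partn.ofRow, hi1] using this
  · rintro ⟨k, hk, rfl⟩ i
    simp only [Partn.ofRow]
    split_ifs <;> simp_all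

/-- Truncated Schur polynomials. -/
def sN {R : Type} [CommRing R] (x : ℕ → R) : ℕ → Partn → R
  | 0, l => if l = Partn.empty then 1 else 0
  | N + 1, l => ∑ mu ∈ dnF l, x N ^ (l.size - mu.size) * sN x N mu

lemma sN_ofRow_succ {R : Type} [CommRing R] (x : ℕ → R) (N m : ℕ) :
    sN x (N + 1) (Partn.ofRow m) =
      ∑ j ∈ Finset.range (m + 1), x N ^ j * sN x N (Partn.ofRow (m - j)) := by
  rw [sN]
  symm
  apply Finset.sum_nbij' (fun j => Partn.ofRow (m - j)) (fun mu => m - mu.size)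
  · intro j hj
    rw [mem_dnF, HS_ofRow]
    exact ⟨m - j, by omega, rfl⟩
  · intro mu hmu
    simp
  · intro j hj
    simp at hj
    simp only [size_ofRow]; omega
  · intro mu hmu
    rw [mem_dnF, HS_ofRow] at hmu
    obtain ⟨k, hk, rfl⟩ := hmu
    simp only [size_ofRow]
    congr 1; omega
  · intro j hj
    simp at hj
    simp only [size_ofRow]
    congr 2; omega



def upRef (mu nu ka : Partn) (h1 : HS ka mu) (h2 : HS ka nu) (j : ℕ) : Partn :=
  Partn.ofFun (fun i => if i = 0 then max (mu.parts 1) (nu.parts 1) + j else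
      max (mu.parts (i + 1)) (nu.parts (i + 1)) + min (mu.parts i) (nu.parts i) - ka.parts i)
    (by
      intro i
      have a1 := h1 i
      have a2 := h2 i
      rw [if_neg (by omega)]
      rcases i with _ | i
      · simp only [↓reduceIte, zero_add, Nat.reduceAdd]
        simp only [zero_add] at a1 a2
        omega
      · have b1 := h1 i
        have b2 := h2 i
        rw [if_neg (by omega)]
        simp only [add_assoc, Nat.reduceAdd] at *
        omega)
    (by
      obtain ⟨L1, hL1⟩ := mu.exists_bound
      refine ⟨L1 + 1, fun i hi => ?_⟩
      have a1 := hL1 i (by omega)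
      obtain ⟨i, rfl⟩ : ∃ k, i = k + 1 := ⟨i - 1, by omega⟩
      have a2 := hL1 (i + 1 + 1) (by omega)
      have a3 := (h2 i).2
      rw [if_neg (by omega)]
      simp only [add_assoc, Nat.reduceAdd] at *
      omega)

def dnRef (mu nu la : Partn) (h1 : HS mu la) (h2 : HS nu la) : Partn :=
  Partn.ofFun (fun i => 
      max (mu.parts (i + 2)) (nu.parts (i + 2)) + min (mu.parts (i + 1)) (nu.parts (i + 1))
        - la.parts (i + 2))
    (by
      intro i
      have a1 := h1 i
      have a2 := h2 i
      have b1 := h1 (i + 1)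
      have b2 := h2 (i + 1)
      have c1 := h1 (i + 2)
      have c2 := h2 (i + 2)
      simp only [add_assoc, Nat.reduceAdd] at *
      omega)
    (by
      obtain ⟨L1, hL1⟩ := mu.exists_bound
      refine ⟨L1 + 1, fun i hi => ?_⟩
      have a1 := hL1 (i + 1) (by omega)
      have a2 := hL1 (i + 2) (by omega)
      have a3 := (h2 (i + 1)).1
      simp only [add_assoc, Nat.reduceAdd] at *
      omega)

lemma upRef_parts_one (mu nu ka h1 h2 j) :
    (upRef mu nu ka h1 h2 j).parts 1 = max (mu.parts 1) (nu.parts 1) + j := by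
  simp [upRef, Partn.ofFun]

lemma upRef_parts (mu nu ka h1 h2 j i) :
    (upRef mu nu ka h1 h2 j).parts (i + 2) =
      max (mu.parts (i + 2)) (nu.parts (i + 2)) + min (mu.parts (i + 1)) (nu.parts (i + 1))
        - ka.parts (i + 1) := by
  simp [upRef, Partn.ofFun]

lemma dnRef_parts (mu nu la h1 h2 i) :
    (dnRef mu nu la h1 h2).parts (i + 1) =
      max (mu.parts (i + 2)) (nu.parts (i + 2)) + min (mu.parts (i + 1)) (nu.parts (i + 1))
        - la.parts (i + 2) := by
  simp [dnRef, Partn.ofFun]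

lemma HS_dnRef_left (mu nu la h1 h2) : HS (dnRef mu nu la h1 h2) mu := by
  intro i
  rw [dnRef_parts]
  have a1 := h1 i
  have a2 := h2 i
  have b1 := h1 (i + 1)
  have b2 := h2 (i + 1)
  simp only [add_assoc, Nat.reduceAdd] at *
  omega

lemma HS_dnRef_right (mu nu la h1 h2) : HS (dnRef mu nu la h1 h2) nu := by
  intro i
  rw [dnRef_parts]
  have a1 := h1 i
  have a2 := h2 i
  have b1 := h1 (i + 1)
  have b2 := h2 (i + 1)
  simp only [add_assoc, Nat.reduceAdd] at *
  omega

lemma HS_upRef_left (mu nu ka h1 h2 j) : HS mu (upRef mu nu ka h1 h2 j) := by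
  intro i
  rw [upRef_parts]
  have a1 := h1 i
  have a2 := h2 i
  rcases i with _ | i
  · rw [zero_add, upRef_parts_one]
    simp only [zero_add] at *
    omega
  rw [upRef_parts]
  have b1 := h1 (i + 1)
  have b2 := h2 (i + 1)
  have b1 := h1 i
  have b2 := h2 i
  simp only [add_assoc, Nat.reduceAdd] at *
  omega

lemma HS_upRef_right (mu nu ka h1 h2 j) : HS nu (upRef mu nu ka h1 h2 j) := by
  intro i
  rw [upRef_parts]
  have a1 := h1 i
  have a2 := h2 i
  rcases i with _ | i
  · rw [zero_add, upRef_parts_one]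
    simp only [zero_add] at *
    omega
  rw [upRef_parts]
  have b1 := h1 (i + 1)
  have b2 := h2 (i + 1)
  have b1 := h1 i
  have b2 := h2 i
  simp only [add_assoc, Nat.reduceAdd] at *
  omega

/-- size relation between the two sides of the reflection -/
lemma ref_size (mu nu ka la : Partn) (j : ℕ) (h0 : la.parts 1 = max (mu.parts 1) (nu.parts 1) + j)
    (h : ∀ i, la.parts (i + 2) + ka.parts (i + 1) = 
      max (mu.parts (i + 2)) (nu.parts (i + 2)) + min (mu.parts (i + 1)) (nu.parts (i + 1))) :
    la.size + ka.size = mu.size + nu.size + j := by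
  obtain ⟨L1, hL1⟩ := mu.exists_bound
  obtain ⟨L2, hL2⟩ := nu.exists_bound
  obtain ⟨L3, hL3⟩ := la.exists_bound
  obtain ⟨L4, hL4⟩ := ka.exists_bound
  set L := L1 + L2 + L3 + L4 with hL
  rw [la.size_eq (L + 1) (fun i hi => hL3 i (by omega)), mu.size_eq (L + 1) (fun i hi => hL1 i (by omega)),
    nu.size_eq (L + 1) (fun i hi => hL2 i (by omega)), ka.size_eq L (fun i hi => hL4 i (by omega)),
    Finset.sum_range_succ' (fun i => la.parts (i + 1))]
  have e1 : ∑ i ∈ Finset.range L, la.parts (i + 1 + 1) + ∑ i ∈ Finset.range L, ka.parts (i + 1) =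
    ∑ i ∈ Finset.range L, max (mu.parts (i + 2)) (nu.parts (i + 2)) +
     ∑ i ∈ Finset.range L, min (mu.parts (i + 1)) (nu.parts (i + 1)) := by
    rw [← Finset.sum_add_distrib, ← Finset.sum_add_distrib]
    exact Finset.sum_congr rfl fun i _ => h i
  have e2 : ∑ i ∈ Finset.range (L + 1), max (mu.parts (i + 1)) (nu.parts (i + 1)) =
    ∑ i ∈ Finset.range L, max (mu.parts (i + 2)) (nu.parts (i + 2)) + max (mu.parts 1) (nu.parts 1) := by
    rw [Finset.sum_range_succ']
  have e3 : ∑ i ∈ Finset.range (L + 1), min (mu.parts (i + 1)) (nu.parts (i + 1)) =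
    ∑ i ∈ Finset.range L, min (mu.parts (i + 1)) (nu.parts (i + 1)) := by
    rw [Finset.sum_range_succ, hL1 (L + 1) (by omega)]; simp
  have e4 : ∑ i ∈ Finset.range (L + 1), max (mu.parts (i + 1)) (nu.parts (i + 1)) +
     ∑ i ∈ Finset.range (L + 1), min (mu.parts (i + 1)) (nu.parts (i + 1)) =
     ∑ i ∈ Finset.range (L + 1), mu.parts (i + 1) + ∑ i ∈ Finset.range (L + 1), nu.parts (i + 1) := by
    rw [← Finset.sum_add_distrib, ← Finset.sum_add_distrib]
    exact Finset.sum_congr rfl fun i _ => max_add_min _ _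
  simp only [zero_add]
  omega

lemma dnRef_size (mu nu la h1 h2) :
    la.size + (dnRef mu nu la h1 h2).size = mu.size + nu.size + 
      (la.parts 1 - max (mu.parts 1) (nu.parts 1)) := by
  apply ref_size
  · have a1 := h1 0
    have a2 := h2 0
    simp only [zero_add] at *
    omega
  · intro i
    rw [dnRef_parts]
    have a1 := h1 i
    have a2 := h2 i
    omega

lemma upRef_size (mu nu ka h1 h2 j) :
    (upRef mu nu ka h1 h2 j).size + ka.size = mu.size + nu.size + j := by
  apply ref_size
  · exact upRef_parts_one ..
  · intro i
    rw [upRef_parts]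
    have a1 := h1 i
    have a2 := h2 i
    omega

lemma upRef_dnRef (mu nu la h1 h2 h3 h4) :
    upRef mu nu (dnRef mu nu la h1 h2) h3 h4 (la.parts 1 - max (mu.parts 1) (nu.parts 1)) = la := by
  apply Partn.ext'
  intro i hi
  obtain ⟨i, rfl⟩ : ∃ k, i = k + 1 := ⟨i - 1, by omega⟩
  rcases i with _ | i
  · rw [zero_add, upRef_parts_one]
    have a1 := h1 0
    have a2 := h2 0
    simp only [zero_add] at *
    omega
  · rw [add_assoc, upRef_parts, dnRef_parts]
    have a1 := h1 i
    have a2 := h2 i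
    have a1 := h1 (i + 1)
    have a2 := h2 (i + 1)
    simp only [add_assoc, Nat.reduceAdd] at *
    omega

lemma dnRef_upRef (mu nu ka h1 h2 j h3 h4) :
    dnRef mu nu (upRef mu nu ka h1 h2 j) h3 h4 = ka := by
  apply Partn.ext'
  intro i hi
  obtain ⟨i, rfl⟩ : ∃ k, i = k + 1 := ⟨i - 1, by omega⟩
  rw [dnRef_parts, upRef_parts]
  have a1 := h1 i
  have a2 := h2 i
  omega

lemma pieri_sN {R : Type} [CommRing R] (x : ℕ → R) (N : ℕ) : ∀ (mu : Partn) (m : ℕ),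
    sN x N mu * sN x N (Partn.ofRow m) = ∑ la ∈ upF mu m, sN x N la := by
  induction N with
  | zero =>
    intro mu m
    simp only [sN]
    by_cases hm : mu = Partn.empty ∧ m = 0
    · obtain ⟨rfl, rfl⟩ := hm
      rw [ofRow_zero, Finset.sum_eq_single Partn.empty]
      · simp
      · intro b _ hb; simp [hb]
      · intro h
        exfalso
        apply h
        rw [mem_upF]
        refine ⟨fun i => by simp [Partn.empty], by simp⟩
    · rw [Finset.sum_eq_zero]
      · by_cases h1 : mu = Partn.empty
        · rw [if_neg (c := Partn.ofRow m = Partn.empty), mul_zero]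
          intro h2
          refine hm ⟨h1, ?_⟩
          rw [← ofRow_zero] at h2
          exact ofRow_inj h2
        · rw [if_neg h1, zero_mul]
      · intro la hla
        rw [mem_upF] at hla
        rw [if_neg]
        rintro rfl
        rw [size_empty] at hla
        exact hm ⟨size_eq_zero (by omega), by omega⟩
  | succ N ih =>
    intro mu m
    rw [sN_ofRow_succ, sN, Finset.sum_mul_sum]
    simp only [sN]
    have key : ∀ ka ∈ dnF mu, ∀ j ∈ Finset.range (m + 1),
        x N ^ (mu.size - ka.size) * sN x N ka * (x N ^ j * sN x N (Partn.ofRow (m - j))) =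
        ∑ nu ∈ upF ka (m - j), x N ^ (mu.size - ka.size + j) * sN x N nu := by
      intro ka _ j _
      rw [← Finset.mul_sum, ← ih, pow_add]; ring
    rw [Finset.sum_congr rfl (fun ka hka => Finset.sum_congr rfl (key ka hka))]
    rw [Finset.sum_sigma', Finset.sum_sigma', Finset.sum_sigma']
    symm
    refine Finset.sum_bij'
      (i := fun (p : (_ : Partn) × Partn) hp => 
        (⟨⟨dnRef mu p.2 p.1 (mem_upF.1 (Finset.mem_sigma.1 hp).1).1 (mem_dnF.1 (Finset.mem_sigma.1 hp).2),
          p.1.parts 1 - max (mu.parts 1) (p.2.parts 1)⟩, p.2⟩ :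
            (_ : (_ : Partn) × ℕ) × Partn))
      (j := fun (q : (_ : (_ : Partn) × ℕ) × Partn) hq => 
        (⟨upRef mu q.2 q.1.1 (mem_dnF.1 (Finset.mem_sigma.1 (Finset.mem_sigma.1 hq).1).1)
          (mem_upF.1 (Finset.mem_sigma.1 hq).2).1 q.1.2, q.2⟩ : (_ : Partn) × Partn))
      ?_ ?_ ?_ ?_ ?_
    · rintro ⟨la, nu⟩ hp
      have h := hp
      simp only [Finset.mem_sigma, mem_upF, mem_dnF] at h
      obtain ⟨⟨h1, h2⟩, h3⟩ := h
      have hs := dnRef_size mu nu la h1 h3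
      have hk := (HS_dnRef_right mu nu la h1 h3).size_le
      simp only [Finset.mem_sigma, mem_upF, mem_dnF, Finset.mem_range]
      exact ⟨⟨HS_dnRef_left _ _ _ _ _, by omega⟩, HS_dnRef_right _ _ _ _ _, by omega⟩
    · rintro ⟨⟨ka, j⟩, nu⟩ hp
      have h := hp
      simp only [Finset.mem_sigma, mem_upF, mem_dnF, Finset.mem_range] at h
      obtain ⟨⟨h1, h2⟩, h3, h4⟩ := h
      have hs := upRef_size mu nu ka h1 h3 j
      simp only [Finset.mem_sigma, mem_upF, mem_dnF, Finset.mem_range]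
      exact ⟨⟨HS_upRef_left _ _ _ _ _ _, by omega⟩, HS_upRef_right _ _ _ _ _ _⟩
    · rintro ⟨la, nu⟩ hp
      simp only [upRef_dnRef]
    · rintro ⟨⟨ka, j⟩, nu⟩ hp
      simp only [dnRef_upRef, upRef_parts_one]
      simp
    · rintro ⟨la, nu⟩ hp
      have h := hp
      simp only [Finset.mem_sigma, mem_upF, mem_dnF] at h
      obtain ⟨⟨h1, h2⟩, h3⟩ := h
      have hs := dnRef_size mu nu la h1 h3
      have hk := (HS_dnRef_right mu nu la h1 h3).size_le
      have hk' := (HS_dnRef_left mu nu la h1 h3).size_le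
      have hk2 := h3.size_le
      congr 2
      simp only
      omega



def loD (mu la : Partn) (i : ℕ) : ℕ := max (mu.parts (i + 1)) (la.parts (i + 2))
def hiD (mu la : Partn) (i : ℕ) : ℕ := if i = 0 then la.parts 1 else min (la.parts (i + 1)) (mu.parts i)

/-- horizontal domino strip -/
def HDS (mu la : Partn) : Prop := ∀ i, loD mu la i ≤ hiD mu la i ∧ Even (hiD mu la i - loD mu la i)

lemma HS_HS_iff {mu ka la : Partn} :
    (HS mu ka ∧ HS ka la) ↔ ∀ i, loD mu la i ≤ ka.parts (i + 1) ∧ ka.parts (i + 1) ≤ hiD mu la i := by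
  constructor
  · rintro ⟨h1, h2⟩ i
    have a1 := h1 i
    have a2 := h2 i
    unfold loD hiD
    rcases i with _ | i
    · simp only [zero_add, ↓reduceIte] at *
      omega
    · have b1 := h1 i
      rw [if_neg (by omega)]
      simp only [add_assoc, Nat.reduceAdd] at *
      omega
  · intro h
    constructor
    · intro i
      have a1 := h i
      have a2 := h (i + 1)
      unfold loD hiD at *
      rw [if_neg (by omega)] at a2
      simp only [add_assoc, Nat.reduceAdd] at *
      omega
    · intro i
      have a1 := h i
      unfold loD hiD at *
      split_ifs at a1
      · subst i
        simp only [zero_add] at *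
        omega
      · omega

lemma HDS.le {mu la : Partn} (h : HDS mu la) (i : ℕ) : mu.parts (i + 1) ≤ la.parts (i + 1) := by
  have := (h i).1
  unfold loD hiD at this
  split_ifs at this
  · subst i
    simp only [zero_add] at *
    omega
  · omega

lemma HDS.size_le {mu la : Partn} (h : HDS mu la) : mu.size ≤ la.size :=
  Partn.size_mono fun i hi => by
    have := h.le (i-1)
    rwa [Nat.sub_add_cancel hi] at this

def midF (mu la : Partn) : Finset Partn := (bF la.size).filter fun ka => HS mu ka ∧ HS ka la

lemma mem_midF {mu ka la : Partn} : ka ∈ midF mu la ↔ HS mu ka ∧ HS ka la := by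
  simp only [midF, Finset.mem_filter, mem_bF]
  exact ⟨fun h => h.2, fun h => ⟨h.2.size_le, h⟩⟩

lemma sum_Icc_sign (lo hi c : ℕ) : ∑ a ∈ Finset.Icc lo hi, (-1 : ℂ) ^ (a + c) =
    if lo ≤ hi ∧ Even (hi - lo) then (-1 : ℂ) ^ (lo + c) else 0 := by
  by_cases h : lo ≤ hi
  · obtain ⟨k, rfl⟩ := Nat.exists_eq_add_of_le h
    simp only [h, true_and, Nat.add_sub_cancel_left]
    clear h
    induction k with
    | zero => simp
    | succ k ih =>
      rw [← add_assoc, Finset.sum_Icc_succ_top (by omega), ih]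
      by_cases hk : Even k
      · rw [if_pos hk, if_neg (by simpa [Nat.even_add_one] using hk)]
        have : (-1 : ℂ) ^ k = 1 := hk.neg_one_pow
        rw [show lo + k + 1 + c = lo + c + k + 1 by ring, pow_succ, pow_add _ _ k, this]; ring
      · rw [if_neg hk, if_pos (by simpa [Nat.even_add_one] using hk)]
        have : (-1 : ℂ) ^ k = -1 := (Nat.not_even_iff_odd.1 hk).neg_one_pow
        rw [show lo + k + 1 + c = lo + c + k + 1 by ring, pow_succ, pow_add _ _ k, this]; ring
  · rw [if_neg (by tauto), Finset.Icc_eq_empty h, Finset.sum_empty]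

lemma parity_aux (mu la : Partn) (h : HDS mu la) (M : ℕ) :
    ((∑ i ∈ Finset.range (M + 1), i * (la.parts (i + 1)) + ∑ i ∈ Finset.range (M + 1), i * (mu.parts (i + 1)) : ℕ) : ZMod 2) = 
    ((∑ i ∈ Finset.range (M + 1), (loD mu la i + mu.parts (i + 1)) : ℕ) : ZMod 2) +
      (M + 1) * ((loD mu la M + mu.parts (M + 1) : ℕ) : ZMod 2) := by
  have h2 : (2 : ZMod 2) = 0 := rfl
  induction M with
  | zero => 
    simp
    linear_combination (-(loD mu la 0 + mu.parts 1 : ZMod 2)) * h2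
  | succ M ih =>
    rw [Finset.sum_range_succ, Finset.sum_range_succ (fun i => i * (mu.parts (i + 1))), 
      Finset.sum_range_succ (fun i => loD mu la i + mu.parts (i + 1))]
    have f : ∃ c, la.parts (M + 2) + mu.parts (M + 2) = 2 * c + ((loD mu la M + mu.parts (M + 1)) +
      (loD mu la (M + 1) + mu.parts (M + 2))) ∨ la.parts (M + 2) + mu.parts (M + 2) + 2 * c = ((loD mu la M + mu.parts (M + 1)) +
      (loD mu la (M + 1) + mu.parts (M + 2))) := by
      obtain ⟨h1, ⟨d, hd⟩⟩ := h (M + 1)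
      rcases le_total (la.parts (M + 2) + mu.parts (M + 2)) ((loD mu la M + mu.parts (M + 1)) +
        (loD mu la (M + 1) + mu.parts (M + 2))) with hc | hc
      · refine ⟨(((loD mu la M + mu.parts (M + 1)) +
          (loD mu la (M + 1) + mu.parts (M + 2))) - (la.parts (M + 2) + mu.parts (M + 2))) / 2, Or.inr ?_⟩
        unfold loD hiD at *
        rw [if_neg (by omega)] at *
        simp only [add_assoc, Nat.reduceAdd] at *
        omega
      · refine ⟨((la.parts (M + 2) + mu.parts (M + 2)) - ((loD mu la M + mu.parts (M + 1)) +
          (loD mu la (M + 1) + mu.parts (M + 2)))) / 2, Or.inl ?_⟩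
        unfold loD hiD at *
        rw [if_neg (by omega)] at *
        simp only [add_assoc, Nat.reduceAdd] at *
        omega
    have f' : (la.parts (M + 2) + mu.parts (M + 2) : ZMod 2) = (loD mu la M + mu.parts (M + 1)) +
      (loD mu la (M + 1) + mu.parts (M + 2)) := by
      obtain ⟨c, hc | hc⟩ := f
      · have := congrArg (Nat.cast (R := ZMod 2)) hc
        push_cast at this
        linear_combination this + c * h2
      · have := congrArg (Nat.cast (R := ZMod 2)) hc
        push_cast at this
        linear_combination this - c * h2
    push_cast at ih ⊢
    simp only [add_assoc, Nat.reduceAdd] at *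
    norm_num at *
    linear_combination ih + (M + 1) * f' + ((M + 1) * (loD mu la M + mu.parts (M + 1)) -
      (loD mu la (M + 1) + mu.parts (M + 2))) * h2

lemma neg_one_pow_congr {a b : ℕ} (h : (a : ZMod 2) = b) : (-1 : ℂ) ^ a = (-1) ^ b := by
  rw [ZMod.natCast_eq_natCast_iff'] at h
  rw [neg_one_pow_eq_pow_mod_two, h, ← neg_one_pow_eq_pow_mod_two]

lemma midF_sum (mu la : Partn) : ∑ ka ∈ midF mu la, (-1 : ℂ) ^ (ka.size + mu.size) =
    if HDS mu la then (-1 : ℂ) ^ (la.nstat + mu.nstat) else 0 := by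
  obtain ⟨L1, hL1⟩ := mu.exists_bound
  obtain ⟨L2, hL2⟩ := la.exists_bound
  obtain ⟨L, hL⟩ : ∃ L, L = L1 + L2 + 1 := ⟨_, rfl⟩
  have hlo : ∀ i, L ≤ i → loD mu la i = 0 := fun i hi => by
    unfold loD
    rw [hL1 _ (by omega), hL2 _ (by omega)]; rfl
  have hhi : ∀ i, L ≤ i → hiD mu la i = 0 := fun i hi => by
    unfold hiD
    rw [if_neg (by omega), hL1 _ (by omega), hL2 _ (by omega)]; rfl
  have step1 : ∑ ka ∈ midF mu la, (-1 : ℂ) ^ (ka.size + mu.size) =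
      ∑ f ∈ Fintype.piFinset (fun i : Fin L => Finset.Icc (loD mu la i) (hiD mu la i)),
        ∏ i : Fin L, (-1 : ℂ) ^ (f i + mu.parts (i + 1)) := by
    refine Finset.sum_bij (fun ka _ => fun i : Fin L => ka.parts (i + 1)) ?_ ?_ ?_ ?_
    · intro ka hka
      rw [mem_midF, HS_HS_iff] at hka
      simp only [Fintype.mem_piFinset, Finset.mem_Icc]
      intro i
      exact hka i
    · intro ka hka ka' hka' heq
      rw [mem_midF, HS_HS_iff] at hka hka'
      apply Partn.ext'
      intro i hi
      obtain ⟨i, rfl⟩ : ∃ k, i = k + 1 := ⟨i - 1, by omega⟩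
      by_cases hiL : i < L
      · exact congrFun heq ⟨i, hiL⟩
      · have := hka i
        have := hka' i
        have := hhi i (by omega)
        omega
    · intro f hf
      simp only [Fintype.mem_piFinset, Finset.mem_Icc] at hf
      let g : ℕ → ℕ := fun i => if h : i < L then f ⟨i, h⟩ else 0
      have hg : ∀ i, loD mu la i ≤ g i ∧ g i ≤ hiD mu la i := by
        intro i
        by_cases hiL : i < L
        · simp only [g, dif_pos hiL]
          exact hf ⟨i, hiL⟩
        · simp only [g, dif_neg hiL]
          rw [hlo i (by omega)]; omega
      let ka := Partn.ofFun g (fun i => by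
        have h1 := (hg i).1
        have h2 := (hg (i + 1)).2
        unfold loD hiD at *
        rw [if_neg (by omega)] at h2
        omega) ⟨L, fun i hi => dif_neg (by omega)⟩
      have hka : ∀ i, ka.parts (i + 1) = g i := fun i => Partn.ofFun_parts ..
      refine ⟨ka, ?_, ?_⟩
      · rw [mem_midF, HS_HS_iff]
        intro i
        rw [hka]
        exact hg i
      · funext i
        rw [hka]
        simp [g]
    · intro ka hka
      rw [mem_midF, HS_HS_iff] at hka
      rw [Finset.prod_pow_eq_pow_sum, Finset.sum_add_distrib, Fin.sum_univ_eq_sum_range (fun i => ka.parts (i + 1)),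
        Fin.sum_univ_eq_sum_range (fun i => mu.parts (i + 1)), ← ka.size_eq, ← mu.size_eq]
      · intro i hi; exact hL1 i (by omega)
      · intro i hi
        obtain ⟨i, rfl⟩ : ∃ k, i = k + 1 := ⟨i - 1, by omega⟩
        have := hka i
        have := hhi i (by omega)
        omega
  rw [step1, ← Finset.prod_univ_sum (fun i : Fin L => Finset.Icc (loD mu la i) (hiD mu la i))
    (fun i a => (-1 : ℂ) ^ (a + mu.parts (i + 1)))]
  simp only [sum_Icc_sign]
  split_ifs with h
  · rw [Finset.prod_congr rfl (fun (i : Fin L) _ => if_pos (h i)), Finset.prod_pow_eq_pow_sum]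
    apply neg_one_pow_congr
    rw [Fin.sum_univ_eq_sum_range (fun i => loD mu la i + mu.parts (i + 1))]
    have := parity_aux mu la h L
    rw [← la.nstat_eq _ (fun i hi => hL2 i (by omega)), ← mu.nstat_eq _ (fun i hi => hL1 i (by omega)),
      hlo L le_rfl, hL1 (L + 1) (by omega), Finset.sum_range_succ,
      hlo L le_rfl, hL1 (L + 1) (by omega)] at this
    simpa using this.symm
  · unfold HDS at h
    push Not at h
    obtain ⟨i, hi⟩ := h
    have hiL : i < L := by
      by_contra hc
      have h1 := hlo i (by omega)
      have h2 := hhi i (by omega)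
      exact hi (by omega) (by rw [h2]; simp)
    apply Finset.prod_eq_zero (Finset.mem_univ ⟨i, hiL⟩)
    rw [if_neg]
    rintro ⟨a, b⟩
    exact hi a b



def cellsF (l : Partn) : Finset (ℕ × ℕ) :=
  (Finset.range (l.size + 1) ×ˢ Finset.range (l.size + 1)).filter l.cell

lemma mem_cellsF {l : Partn} {c : ℕ × ℕ} : c ∈ cellsF l ↔ l.cell c := by
  simp only [cellsF, Finset.mem_filter, Finset.mem_product, Finset.mem_range, and_iff_right_iff_imp]
  rintro ⟨h1, h2, h3⟩
  have := l.parts_le_size c.1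
  refine ⟨?_, by omega⟩
  by_contra hc
  have := l.parts_eq_zero c.1 (by omega)
  omega

lemma card_cellsF (l : Partn) : (cellsF l).card = l.size := by
  rw [Finset.card_eq_sum_card_fiberwise (f := Prod.fst) (t := Finset.range (l.size + 1))]
  · rw [Finset.sum_range_succ']
    have h0 : (cellsF l).filter (fun a => a.1 = 0) = ∅ := by
      ext c
      simp only [Finset.mem_filter, mem_cellsF, Partn.cell]
      simp; omega
    rw [h0, Finset.card_empty, add_zero]
    refine Eq.trans ?_ (l.size_eq l.size l.parts_eq_zero).symm
    apply Finset.sum_congr rfl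
    intro i _
    rw [show l.parts (i + 1) = (Finset.Icc 1 (l.parts (i + 1))).card by simp]
    symm
    apply Finset.card_bij (fun j _ => (i + 1, j))
    · intro j hj
      simp only [Finset.mem_Icc] at hj
      simp only [Finset.mem_filter, mem_cellsF]
      exact ⟨⟨by simp, hj.1, hj.2⟩, trivial⟩
    · intro a _ b _ h
      simpa using h
    · rintro ⟨a, b⟩ h
      simp only [Finset.mem_filter, mem_cellsF, Partn.cell] at h
      obtain ⟨⟨h1, h2, h3⟩, rfl⟩ := h
      exact ⟨b, by simp; omega, rfl⟩
  · intro c hc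
    simp only [Finset.mem_coe, cellsF, Finset.mem_filter, Finset.mem_product] at hc
    exact hc.1.1

lemma parts_le_of_cell {l m : Partn} (h : ∀ c, l.cell c → m.cell c) (i : ℕ) :
    l.parts (i + 1) ≤ m.parts (i + 1) := by
  rcases Nat.eq_zero_or_pos (l.parts (i + 1)) with h0 | h0
  · omega
  · exact (h (i + 1, l.parts (i + 1)) ⟨by simp, h0, le_rfl⟩).2.2

lemma eq_of_cell {l m : Partn} (h : ∀ c, l.cell c ↔ m.cell c) : l = m := by
  apply Partn.ext'
  intro i hi
  obtain ⟨i, rfl⟩ : ∃ k, i = k + 1 := ⟨i - 1, by omega⟩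
  exact le_antisymm (parts_le_of_cell (fun c => (h c).1) i) (parts_le_of_cell (fun c => (h c).2) i)

lemma exists_sub (l : Partn) (Q : ℕ × ℕ → Prop) (h1 : ∀ c, Q c → l.cell c)
    (h2 : ∀ i j, 1 ≤ j → Q (i, j + 1) → Q (i, j)) (h3 : ∀ i j, 1 ≤ i → Q (i + 1, j) → Q (i, j)) :
    ∃ mu : Partn, ∀ c, mu.cell c ↔ Q c := by
  let p : ℕ → ℕ := fun i => Nat.findGreatest (fun j => Q (i, j)) (l.parts i)
  have hp : ∀ i j, 1 ≤ j → (j ≤ p i ↔ Q (i, j)) := by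
    intro i j hj
    constructor
    · intro hjp
      have hQ : Q (i, p i) := Nat.findGreatest_of_ne_zero (P := fun j => Q (i, j)) (m := p i) rfl (by omega)
      obtain ⟨k, hk⟩ := Nat.exists_eq_add_of_le hjp
      rw [hk] at hQ
      clear hk hjp
      induction k with
      | zero => exact hQ
      | succ k ih => exact ih (h2 _ _ (by omega) hQ)
    · intro hQ
      exact Nat.le_findGreatest (h1 _ hQ).2.2 hQ
  have hp0 : ∀ i, l.parts i = 0 → p i = 0 := by
    intro i hi
    have : p i ≤ l.parts i := Nat.findGreatest_le _
    omega
  refine ⟨⟨p, hp0 0 l.parts_zero, ?_, ?_⟩, ?_⟩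
  · intro i j hi hij
    obtain ⟨k, rfl⟩ := Nat.exists_eq_add_of_le hij
    clear hij
    induction k with
    | zero => exact le_rfl
    | succ k ih =>
      refine le_trans ?_ ih
      rcases Nat.eq_zero_or_pos (p (i + (k + 1))) with h0 | h0
      · omega
      · rw [hp _ _ h0]
        apply h3 _ _ (by omega)
        exact (hp _ _ h0).1 le_rfl
  · apply l.parts_finite.subset
    intro i hi hc
    exact hi (hp0 i hc)
  · rintro ⟨i, j⟩
    simp only [Partn.cell]
    constructor
    · rintro ⟨a, b, c⟩
      exact (hp i j b).1 c
    · intro hQ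
      have := h1 _ hQ
      exact ⟨this.1, this.2.1, (hp i j this.2.1).2 hQ⟩

lemma card_fiber {α : Type} [Finite α] (I : Finset Partn) (P : α → Partn → Prop)
    (hex : ∀ a, ∃ mu ∈ I, P a mu) (hu : ∀ a mu nu, P a mu → P a nu → mu = nu) :
    Nat.card α = ∑ mu ∈ I, Nat.card {a // P a mu} := by
  have := Fintype.ofFinite α
  choose F hF1 hF2 using hex
  rw [Nat.card_eq_fintype_card, ← Finset.card_univ,
    Finset.card_eq_sum_card_fiberwise (f := F) (t := I) (fun a _ => hF1 a)]
  apply Finset.sum_congr rfl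
  intro mu _
  rw [Nat.card_eq_fintype_card, Fintype.card_subtype]
  congr 1
  ext a
  simp only [Finset.mem_filter, Finset.mem_univ, true_and]
  exact ⟨fun h => h ▸ hF2 a, fun h => hu a _ _ (hF2 a) h⟩

/-- number of cells with label `k` -/
def lab (l : Partn) (e : ℕ × ℕ → ℕ) (k : ℕ) : ℕ := ((cellsF l).filter fun c => e c = k).card

lemma lab_eq_ncard (l : Partn) (e : ℕ × ℕ → ℕ) (k : ℕ) :
    {c : ℕ × ℕ | l.cell c ∧ e c = k}.ncard = lab l e k := by
  rw [lab, ← Set.ncard_coe_finset]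
  congr 1
  ext c
  simp [mem_cellsF]

lemma le_of_lab {l : Partn} {e : ℕ × ℕ → ℕ} {N : ℕ} (h : ∀ k, N < k → lab l e k = 0)
    (c : ℕ × ℕ) (hc : l.cell c) : e c ≤ N := by
  by_contra hh
  have := h (e c) (by omega)
  rw [lab, Finset.card_eq_zero] at this
  have h2 : c ∈ (cellsF l).filter fun c' => e c' = e c := by
    simp [mem_cellsF, hc]
  rw [this] at h2
  simp at h2

/-- If `mu` is the set of cells with label `≤ N` in `la` and the labels are `≤ N+1`. -/
lemma size_lab {mu la : Partn} {e : ℕ × ℕ → ℕ} {N : ℕ}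
    (h : ∀ c, mu.cell c ↔ la.cell c ∧ e c ≤ N) (hN : ∀ c, la.cell c → e c ≤ N + 1) :
    la.size = mu.size + lab la e (N + 1) := by
  rw [← card_cellsF la, ← card_cellsF mu, lab,
    ← Finset.card_filter_add_card_filter_not (s := cellsF la) (fun c => e c ≤ N)]
  congr 2
  · ext c
    simp [mem_cellsF, h]
  · ext c
    simp only [Finset.mem_filter, mem_cellsF]
    constructor
    · rintro ⟨a, b⟩
      exact ⟨a, by have := hN c a; omega⟩
    · rintro ⟨a, b⟩
      exact ⟨a, by omega⟩

lemma lab_congr {mu la : Partn} {e e' : ℕ × ℕ → ℕ} {N : ℕ}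
    (h : ∀ c, mu.cell c ↔ la.cell c ∧ e c ≤ N) (he : ∀ c, mu.cell c → e' c = e c) (k : ℕ) (hk : k ≤ N) :
    lab mu e' k = lab la e k := by
  unfold lab
  congr 1
  ext c
  simp only [Finset.mem_filter, mem_cellsF]
  constructor
  · rintro ⟨a, b⟩
    exact ⟨((h c).1 a).1, by rw [← he c a, b]⟩
  · rintro ⟨a, b⟩
    have : mu.cell c := (h c).2 ⟨a, by omega⟩
    exact ⟨this, by rw [he c this, b]⟩

lemma lab_zero {l : Partn} {e : ℕ × ℕ → ℕ} {N : ℕ} (h : ∀ c, l.cell c → e c ≤ N) (k : ℕ) (hk : N < k) :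
    lab l e k = 0 := by
  rw [lab, Finset.card_eq_zero]
  ext c
  simp only [Finset.mem_filter, mem_cellsF, Finset.notMem_empty, iff_false]
  rintro ⟨a, b⟩
  have := h c a
  omega

lemma cell_left {l : Partn} {i j : ℕ} (h : l.cell (i, j + 1)) (hj : 1 ≤ j) : l.cell (i, j) := by
  simp only [Partn.cell] at *
  omega
lemma cell_up {l : Partn} {i j : ℕ} (h : l.cell (i + 1, j)) (hi : 1 ≤ i) : l.cell (i, j) := by
  simp only [Partn.cell] at *
  have := l.parts_antitone hi (show i ≤ i + 1 by omega)
  omega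

/-! ### SSYT recursion -/

@[ext] lemma SSYT.ext' {l : Partn} {S T : SSYT l} (h : ∀ c, S.entry c = T.entry c) : S = T := by
  have : S.entry = T.entry := funext h
  cases S; cases T; simp_all

abbrev CT (l : Partn) (N : ℕ) (f : ℕ → ℕ) : Type :=
  {T : SSYT l // ∀ k, 1 ≤ k → lab l T.entry k = if k ≤ N then f k else 0}

lemma CT.le {l : Partn} {N : ℕ} {f : ℕ → ℕ} (T : CT l N f) (c : ℕ × ℕ) : T.1.entry c ≤ N := by
  by_cases hc : l.cell c
  · apply le_of_lab (fun k hk => ?_) c hc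
    rw [T.2 k (by omega), if_neg (by omega)]
  · rw [T.1.entry_outside c hc]; omega

instance (l : Partn) (N : ℕ) (f : ℕ → ℕ) : Finite (CT l N f) := by
  apply Finite.of_injective (β := (cellsF l) → Fin (N + 1))
    (fun T c => ⟨T.1.entry c.1, by have := T.le c.1; omega⟩)
  intro S T h
  apply Subtype.ext
  apply SSYT.ext'
  intro c
  by_cases hc : l.cell c
  · have := congrFun h ⟨c, mem_cellsF.2 hc⟩
    simpa using this
  · rw [S.1.entry_outside c hc, T.1.entry_outside c hc]

def SSYT.restr {la mu : Partn} (N : ℕ) (T : SSYT la)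
    (h : ∀ c, mu.cell c ↔ la.cell c ∧ T.entry c ≤ N) : SSYT mu where
  entry c := if mu.cell c then T.entry c else 0
  entry_pos c hc := by rw [if_pos hc]; exact T.entry_pos c ((h c).1 hc).1
  entry_outside c hc := if_neg hc
  row_weak i j hc := by
    rw [if_pos hc]
    split_ifs
    · exact T.row_weak i j ((h _).1 hc).1
    · omega
  col_strict i j hi hc := by
    rw [if_pos hc, if_pos (cell_up hc hi)]
    exact T.col_strict i j hi ((h _).1 hc).1

def SSYT.extd {la mu : Partn} (N : ℕ) (U : SSYT mu) (hN : ∀ c, U.entry c ≤ N)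
    (h : HS mu la) : SSYT la where
  entry c := if mu.cell c then U.entry c else if la.cell c then N + 1 else 0
  entry_pos c hc := by
    split_ifs with h1
    · exact U.entry_pos c h1
    · omega
  entry_outside c hc := by
    rw [if_neg, if_neg hc]
    rintro ⟨h1, h2, h3⟩
    apply hc
    have := (h (c.1 - 1)).1
    rw [Nat.sub_add_cancel h1] at this
    exact ⟨h1, h2, h3.trans this⟩
  row_weak i j hc := by
    by_cases h1 : mu.cell (i, j + 1)
    · rw [if_pos h1]
      rcases Nat.eq_zero_or_pos j with rfl | hj
      · rw [if_neg, if_neg]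
        · omega
        · simp [Partn.cell]
        · simp [Partn.cell]
      · rw [if_pos (cell_left h1 hj)]
        exact U.row_weak i j h1
    · rw [if_neg h1, if_pos hc]
      have := hN (i, j)
      split_ifs <;> omega
  col_strict i j hi hc := by
    by_cases h1 : mu.cell (i + 1, j)
    · rw [if_pos h1, if_pos (cell_up h1 hi)]
      exact U.col_strict i j hi h1
    · have : mu.cell (i, j) := by
        obtain ⟨a, b, c⟩ := hc
        have := (h (i - 1)).2
        rw [show i - 1 + 2 = i + 1 by omega, show i - 1 + 1 = i by omega] at this
        exact ⟨hi, b, c.trans this⟩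
      rw [if_neg h1, if_pos hc, if_pos this]
      have := hN (i, j)
      omega

lemma HS.cell {mu la : Partn} (h : HS mu la) {c : ℕ × ℕ} (hc : mu.cell c) : la.cell c := by
  obtain ⟨h1, h2, h3⟩ := hc
  have := (h (c.1 - 1)).1
  rw [Nat.sub_add_cancel h1] at this
  exact ⟨h1, h2, h3.trans this⟩

lemma card_CT_succ (la : Partn) (N : ℕ) (f : ℕ → ℕ) :
    Nat.card (CT la (N + 1) f) = ∑ mu ∈ dnF la,
      if la.size = mu.size + f (N + 1) then Nat.card (CT mu N f) else 0 := by
  rw [← Finset.sum_filter, card_fiber ((dnF la).filter fun mu => la.size = mu.size + f (N + 1))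
    (fun (T : CT la (N + 1) f) mu => ∀ c, mu.cell c ↔ la.cell c ∧ T.1.entry c ≤ N)]
  · apply Finset.sum_congr rfl
    intro mu hmu
    rw [Finset.mem_filter, mem_dnF] at hmu
    obtain ⟨hHS, hsz⟩ := hmu
    have aux : ∀ (U : CT mu N f) c, mu.cell c ↔ la.cell c ∧ (U.1.extd N U.le hHS).entry c ≤ N := by
      intro U c
      simp only [SSYT.extd]
      constructor
      · intro hc
        rw [if_pos hc]
        exact ⟨hHS.cell hc, U.le c⟩
      · rintro ⟨a, b⟩
        by_contra hc
        rw [if_neg hc, if_pos a] at b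
        omega
    refine Nat.card_congr ⟨fun T => ⟨T.1.1.restr N T.2, ?_⟩, fun U => ⟨⟨U.1.extd N U.le hHS, ?_⟩, aux U⟩, ?_, ?_⟩
    · intro k hk
      split_ifs with hkN
      · rw [lab_congr T.2 (fun c hc => by simp [SSYT.restr, hc]) k hkN, T.1.2 k hk, if_pos (by omega)]
      · apply lab_zero (N := N) _ k (by omega)
        intro c hc
        simp only [SSYT.restr, hc, if_true]
        exact ((T.2 c).1 hc).2
    · intro k hk
      have hb : ∀ c, la.cell c → (U.1.extd N U.le hHS).entry c ≤ N + 1 := by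
        intro c hc
        simp only [SSYT.extd]
        have := U.le c
        split_ifs <;> omega
      rcases Nat.lt_trichotomy k (N + 1) with hkN | rfl | hkN
      · rw [← lab_congr (e' := U.1.entry) (aux U) (fun c hc => by simp [SSYT.extd, hc]) k (by omega), U.2 k hk,
          if_pos (by omega), if_pos (by omega)]
      · have := size_lab (aux U) hb
        rw [if_pos le_rfl]
        omega
      · rw [if_neg (by omega)]
        exact lab_zero hb k hkN
    · intro T
      apply Subtype.ext
      apply Subtype.ext
      apply SSYT.ext'
      intro c
      simp only [SSYT.restr, SSYT.extd]
      by_cases hc : mu.cell c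
      · simp [hc]
      · simp only [hc, if_false]
        by_cases hl : la.cell c
        · have h1 := T.1.le c
          have h2 : ¬ T.1.1.entry c ≤ N := fun h => hc ((T.2 c).2 ⟨hl, h⟩)
          simp only [hl, if_true]
          omega
        · simp only [hl, if_false]
          rw [T.1.1.entry_outside c hl]
    · intro U
      apply Subtype.ext
      apply SSYT.ext'
      intro c
      simp only [SSYT.restr, SSYT.extd]
      by_cases hc : mu.cell c
      · simp [hc]
      · simp only [hc, if_false]
        rw [U.1.entry_outside c hc]
  · intro T
    obtain ⟨mu, hmu⟩ := exists_sub la (fun c => la.cell c ∧ T.1.entry c ≤ N) (fun c hc => hc.1)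
      (fun i j hj hc => ⟨cell_left hc.1 hj, (T.1.row_weak i j hc.1).trans hc.2⟩)
      (fun i j hi hc => ⟨cell_up hc.1 hi, (T.1.col_strict i j hi hc.1).le.trans hc.2⟩)
    refine ⟨mu, ?_, hmu⟩
    rw [Finset.mem_filter, mem_dnF]
    constructor
    · intro i
      refine ⟨parts_le_of_cell (fun c hc => ((hmu c).1 hc).1) i, ?_⟩
      rcases Nat.eq_zero_or_pos (la.parts (i + 2)) with h0 | h0
      · omega
      · have hc : la.cell (i + 1 + 1, la.parts (i + 2)) := ⟨by simp, h0, le_rfl⟩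
        have h1 := T.1.col_strict (i + 1) _ (by omega) hc
        have h2 := T.le (i + 1 + 1, la.parts (i + 2))
        exact ((hmu (i + 1, la.parts (i + 2))).2 ⟨cell_up hc (by omega), by omega⟩).2.2
    · have := size_lab hmu (fun c _ => T.le c)
      rwa [T.2 (N + 1) (by omega), if_pos le_rfl] at this
  · intro T mu nu h1 h2
    exact eq_of_cell fun c => (h1 c).trans (h2 c).symm

lemma card_CT_zero (la : Partn) (f : ℕ → ℕ) :
    Nat.card (CT la 0 f) = if la = Partn.empty then 1 else 0 := by
  have h0 : ∀ T : CT la 0 f, ∀ c, ¬ la.cell c := by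
    intro T c hc
    have := T.le c
    have := T.1.entry_pos c hc
    omega
  split_ifs with h
  · subst h
    have hc : ∀ c, ¬ Partn.empty.cell c := by
      rintro c ⟨h1, h2, h3⟩
      simp [Partn.empty] at h3; omega
    rw [Nat.card_eq_one_iff_unique]
    constructor
    · constructor
      intro S T
      apply Subtype.ext
      apply SSYT.ext'
      intro c
      rw [S.1.entry_outside c (hc c), T.1.entry_outside c (hc c)]
    · refine ⟨⟨⟨fun _ => 0, fun c h => absurd h (hc c), fun _ _ => rfl, fun i j h => absurd h (hc _),
        fun i j _ h => absurd h (hc _)⟩, ?_⟩⟩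
      intro k hk
      rw [if_neg (by omega)]
      exact lab_zero (N := 0) (by simp) k (by omega)
  · rw [Nat.card_eq_zero]
    left
    constructor
    intro T
    apply h
    apply eq_of_cell
    intro c
    constructor
    · intro hc; exact absurd hc (h0 T c)
    · rintro ⟨h1, h2, h3⟩
      simp [Partn.empty] at h3; omega

lemma CT_congr (la : Partn) (N : ℕ) (f g : ℕ → ℕ) (h : ∀ k, 1 ≤ k → k ≤ N → f k = g k) :
    Nat.card (CT la N f) = Nat.card (CT la N g) := by
  apply Nat.card_congr
  apply Equiv.subtypeEquivRight
  intro T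
  apply forall_congr'
  intro k
  apply forall_congr'
  intro hk
  split_ifs with h1
  · rw [h k hk h1]
  · rfl



lemma coeff_sN (N : ℕ) : ∀ (la : Partn) (d : ℕ →₀ ℕ),
    MvPowerSeries.coeff d (sN (fun i => (MvPowerSeries.X i : MvPowerSeries ℕ ℂ)) N la) =
      if (∀ i, N ≤ i → d i = 0) then (Nat.card (CT la N (fun k => d (k - 1))) : ℂ) else 0 := by
  induction N with
  | zero =>
    intro la d
    rw [card_CT_zero]
    have : (∀ i, 0 ≤ i → d i = 0) ↔ d = 0 := by
      constructor
      · intro h; ext i; exact h i (Nat.zero_le _)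
      · rintro rfl; simp
    simp only [this, sN]
    by_cases h : la = Partn.empty
    · simp [h, MvPowerSeries.coeff_one]
    · simp [h]
  | succ N ih =>
    intro la d
    rw [sN, map_sum]
    by_cases hd : ∀ i, N + 1 ≤ i → d i = 0
    · rw [if_pos hd, card_CT_succ, Nat.cast_sum]
      apply Finset.sum_congr rfl
      intro mu hmu
      have hle := (mem_dnF.1 hmu).size_le
      rw [MvPowerSeries.X_pow_eq, MvPowerSeries.coeff_monomial_mul]
      have e : (N + 1 - 1) = N := by omega
      simp only [Finsupp.single_le_iff, ih, one_mul, e]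
      by_cases h1 : la.size = mu.size + d N
      · have h2 : la.size - mu.size = d N := by omega
        rw [if_pos h1, h2, if_pos le_rfl, if_pos]
        · congr 1
          apply CT_congr
          intro k hk hk'
          simp only [Finsupp.tsub_apply, Finsupp.single_apply]
          rw [if_neg (by omega)]; omega
        · intro i hi
          simp only [Finsupp.tsub_apply, Finsupp.single_apply]
          split_ifs with h
          · subst h; omega
          · rw [hd i (by omega)]; rfl
      · rw [if_neg h1]
        split_ifs with h2 h3
        · exfalso
          have := h3 N le_rfl
          simp only [Finsupp.tsub_apply, Finsupp.single_apply, if_true] at this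
          omega
        · simp
        · simp
    · rw [if_neg hd]
      apply Finset.sum_eq_zero
      intro mu hmu
      rw [MvPowerSeries.X_pow_eq, MvPowerSeries.coeff_monomial_mul]
      split_ifs with h
      · rw [ih, if_neg, mul_zero]
        intro hh
        apply hd
        intro i hi
        have := hh i (by omega)
        simp only [Finsupp.tsub_apply, Finsupp.single_apply] at this
        rw [if_neg (by omega)] at this
        omega
      · rfl

lemma coeff_sSchur (N : ℕ) (la : Partn) (d : ℕ →₀ ℕ) (hd : ∀ i, N ≤ i → d i = 0) :
    MvPowerSeries.coeff d (sSchur la) =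
    MvPowerSeries.coeff d (sN (fun i => (MvPowerSeries.X i : MvPowerSeries ℕ ℂ)) N la) := by
  rw [coeff_sN, if_pos hd]
  show ((Nat.card {T : SSYT la // ∀ k, 1 ≤ k → T.wt k = d (k - 1)} : ℕ) : ℂ) = _
  congr 1
  apply Nat.card_congr
  apply Equiv.subtypeEquivRight
  intro T
  apply forall_congr'
  intro k
  apply forall_congr'
  intro hk
  rw [SSYT.wt, lab_eq_ncard]
  split_ifs with h
  · rfl
  · rw [hd (k - 1) (by omega)]

lemma exists_N (d : ℕ →₀ ℕ) : ∃ N, ∀ i, N ≤ i → d i = 0 := by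
  refine ⟨d.support.sup id + 1, fun i hi => ?_⟩
  by_contra h
  have : id i ≤ d.support.sup id := Finset.le_sup (by simpa using h)
  simp at this
  omega

lemma pieri (mu : Partn) (m : ℕ) :
    sSchur mu * sSchur (Partn.ofRow m) = ∑ la ∈ upF mu m, sSchur la := by
  ext d
  obtain ⟨N, hN⟩ := exists_N d
  rw [map_sum, Finset.sum_congr rfl (fun la _ => coeff_sSchur N la d hN), ← map_sum, ← pieri_sN,
    MvPowerSeries.coeff_mul, MvPowerSeries.coeff_mul]
  apply Finset.sum_congr rfl
  rintro ⟨a, b⟩ hab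
  rw [Finset.HasAntidiagonal.mem_antidiagonal] at hab
  simp only at hab ⊢
  have : ∀ i, N ≤ i → a i = 0 ∧ b i = 0 := by
    intro i hi
    have := hN i hi
    rw [← hab, Finsupp.add_apply] at this
    omega
  rw [coeff_sSchur N mu a (fun i hi => (this i hi).1), coeff_sSchur N _ b (fun i hi => (this i hi).2)]

lemma HS.trans_size {mu ka la : Partn} (h1 : HS mu ka) (h2 : HS ka la) : mu.size ≤ la.size :=
  h1.size_le.trans h2.size_le

lemma step (mu : Partn) (m : ℕ) :
    sSchur mu * ∑ i ∈ Finset.range (2 * m + 1),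
      ((-1 : ℂ) ^ i) • (sSchur (Partn.ofRow i) * sSchur (Partn.ofRow (2 * m - i))) =
    ∑ la ∈ (bF (mu.size + 2 * m)).filter (fun la => HDS mu la ∧ la.size = mu.size + 2 * m),
      ((-1 : ℂ) ^ (la.nstat + mu.nstat)) • sSchur la := by
  have h1 : ∀ i ∈ Finset.range (2 * m + 1),
      sSchur mu * (((-1 : ℂ) ^ i) • (sSchur (Partn.ofRow i) * sSchur (Partn.ofRow (2 * m - i)))) =
      ∑ la ∈ (bF (mu.size + 2 * m)).filter (fun la => la.size = mu.size + 2 * m),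
        ∑ ka ∈ (midF mu la).filter (fun ka => ka.size = mu.size + i),
          ((-1 : ℂ) ^ (ka.size + mu.size)) • sSchur la := by
    intro i hi
    rw [Finset.mem_range] at hi
    rw [mul_smul_comm, ← mul_assoc, pieri, Finset.sum_mul, Finset.smul_sum]
    rw [Finset.sum_congr rfl (fun ka _ => by rw [pieri, Finset.smul_sum])]
    rw [Finset.sum_comm' (s := upF mu i) (t := fun ka => upF ka (2 * m - i))
      (t' := (bF (mu.size + 2 * m)).filter (fun la => la.size = mu.size + 2 * m))
      (s' := fun la => (midF mu la).filter (fun ka => ka.size = mu.size + i))]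
    · apply Finset.sum_congr rfl
      intro la hla
      apply Finset.sum_congr rfl
      intro ka hka
      rw [Finset.mem_filter] at hka
      rw [neg_one_pow_congr]
      rw [hka.2, show mu.size + i + mu.size = i + 2 * mu.size by ring]
      push_cast
      rw [show (2 : ZMod 2) = 0 from rfl]
      ring
    · intro ka la
      simp only [mem_upF, Finset.mem_filter, mem_midF, mem_bF]
      constructor
      · rintro ⟨⟨a, b⟩, c, d⟩
        exact ⟨⟨⟨a, c⟩, b⟩, by omega, by omega⟩
      · rintro ⟨⟨⟨a, c⟩, b⟩, -, d⟩
        exact ⟨⟨a, b⟩, c, by omega⟩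
  rw [Finset.mul_sum, Finset.sum_congr rfl h1, Finset.sum_comm,
    Finset.filter_congr (q := fun la => la.size = mu.size + 2 * m ∧ HDS mu la) (fun la _ => and_comm),
    ← Finset.filter_filter]
  refine Eq.trans ?_ (Finset.sum_filter _ _).symm
  apply Finset.sum_congr rfl
  intro la hla
  rw [Finset.mem_filter] at hla
  have h2 : ∑ i ∈ Finset.range (2 * m + 1), ∑ ka ∈ (midF mu la).filter (fun ka => ka.size = mu.size + i),
      ((-1 : ℂ) ^ (ka.size + mu.size)) • sSchur la =
      ∑ ka ∈ midF mu la, ((-1 : ℂ) ^ (ka.size + mu.size)) • sSchur la := by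
    rw [← Finset.sum_fiberwise_of_maps_to (s := midF mu la) (t := Finset.range (2 * m + 1))
      (g := fun ka => ka.size - mu.size)]
    · apply Finset.sum_congr rfl
      intro i hi
      congr 1
      apply Finset.filter_congr
      intro ka hka
      have := (mem_midF.1 hka).1.size_le
      omega
    · intro ka hka
      have := (mem_midF.1 hka).2.size_le
      rw [Finset.mem_range]
      omega
  rw [h2, ← Finset.sum_smul, midF_sum]
  split_ifs <;> simp



def Sk (mu la : Partn) (c : ℕ × ℕ) : Prop := 1 ≤ c.1 ∧ mu.parts c.1 < c.2 ∧ c.2 ≤ la.parts c.1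

lemma Sk_iff {mu la : Partn} {c : ℕ × ℕ} : Sk mu la c ↔ la.cell c ∧ ¬ mu.cell c := by
  unfold Sk Partn.cell
  constructor
  · rintro ⟨a, b, d⟩; exact ⟨⟨a, by omega, d⟩, by omega⟩
  · rintro ⟨⟨a, b, d⟩, e⟩; exact ⟨a, by omega, d⟩

def cm (mu la : Partn) (c : ℕ × ℕ) : ℕ × ℕ :=
  if Sk mu la c then
    if Sk mu la (c.1 + 1, c.2) then (c.1 + 1, c.2)
    else if Sk mu la (c.1 - 1, c.2) then (c.1 - 1, c.2)
    else if Odd (c.2 - loD mu la (c.1 - 1)) then (c.1, c.2 + 1) else (c.1, c.2 - 1)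
  else c

lemma single_iff {mu la : Partn} {i j : ℕ} :
    (loD mu la i < j ∧ j ≤ hiD mu la i) ↔
      (Sk mu la (i + 1, j) ∧ ¬ Sk mu la (i + 2, j) ∧ ¬ Sk mu la (i, j)) := by
  have h2 := mu.parts_antitone (show 1 ≤ i + 1 by omega) (show i + 1 ≤ i + 2 by omega)
  unfold Sk loD hiD
  rcases Nat.eq_zero_or_pos i with rfl | hi
  · simp only [if_true, zero_add] at *
    omega
  · have h1 := la.parts_antitone (show 1 ≤ i from hi) (show i ≤ i + 1 by omega)
    rw [if_neg (by omega)]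
    simp only
    omega

lemma no_three {mu la : Partn} (h : HDS mu la) {i j : ℕ} (h1 : Sk mu la (i, j)) (h2 : Sk mu la (i + 2, j)) :
    False := by
  have := (h i).1
  unfold Sk at h1 h2
  unfold loD hiD at this
  rw [if_neg (by omega)] at this
  simp only at *
  omega

lemma cm_below {mu la : Partn} {i j : ℕ} (h1 : Sk mu la (i, j)) (h2 : Sk mu la (i + 1, j)) :
    cm mu la (i, j) = (i + 1, j) := by
  rw [cm, if_pos h1, if_pos h2]

lemma cm_above {mu la : Partn} (h : HDS mu la) {i j : ℕ} (h1 : Sk mu la (i, j)) (h2 : Sk mu la (i + 1, j)) :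
    cm mu la (i + 1, j) = (i, j) := by
  rw [cm, if_pos h2, if_neg (fun h3 => no_three h h1 h3)]
  simp [h1]

lemma cm_odd {mu la : Partn} {i j : ℕ} (h1 : loD mu la i < j) (h2 : j ≤ hiD mu la i)
    (h3 : Odd (j - loD mu la i)) : cm mu la (i + 1, j) = (i + 1, j + 1) := by
  obtain ⟨a, b, c⟩ := single_iff.1 ⟨h1, h2⟩
  rw [cm, if_pos a, if_neg b]
  simp [c, h3]

lemma cm_even {mu la : Partn} {i j : ℕ} (h1 : loD mu la i < j) (h2 : j ≤ hiD mu la i)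
    (h3 : ¬ Odd (j - loD mu la i)) : cm mu la (i + 1, j) = (i + 1, j - 1) := by
  obtain ⟨a, b, c⟩ := single_iff.1 ⟨h1, h2⟩
  rw [cm, if_pos a, if_neg b]
  simp [c, h3]

/-- cm is a valid matching -/
lemma cm_spec {mu la : Partn} (h : HDS mu la) {c : ℕ × ℕ} (hc : Sk mu la c) :
    Sk mu la (cm mu la c) ∧ adjCell c (cm mu la c) ∧ cm mu la (cm mu la c) = c := by
  obtain ⟨i, j⟩ := c
  obtain ⟨i, rfl⟩ : ∃ k, i = k + 1 := ⟨i - 1, by have := hc.1; simp only at this; omega⟩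
  by_cases hb : Sk mu la (i + 1 + 1, j)
  · rw [cm_below hc hb]
    exact ⟨hb, by simp [adjCell], cm_above h hc hb⟩
  by_cases ha : Sk mu la (i, j)
  · rw [cm_above h ha hc]
    exact ⟨ha, by simp [adjCell], cm_below ha hc⟩
  obtain ⟨h1, h2⟩ := single_iff.2 ⟨hc, hb, ha⟩
  obtain ⟨h4, h5⟩ := h i
  by_cases ho : Odd (j - loD mu la i)
  · have h6 : j + 1 ≤ hiD mu la i := by
      rw [Nat.odd_iff] at ho
      rw [Nat.even_iff] at h5
      omega
    rw [cm_odd h1 h2 ho]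
    refine ⟨(single_iff.1 ⟨by omega, h6⟩).1, by simp [adjCell], ?_⟩
    rw [cm_even (by omega) h6]
    · rfl
    · rw [Nat.odd_iff] at ho ⊢; omega
  · have h6 : loD mu la i < j - 1 := by
      rw [Nat.odd_iff] at ho
      omega
    rw [cm_even h1 h2 ho]
    refine ⟨(single_iff.1 ⟨h6, by omega⟩).1, ?_, ?_⟩
    · simp [adjCell]; omega
    · rw [cm_odd h6 (by omega)]
      · rw [Nat.sub_add_cancel (by omega)]
      · rw [Nat.odd_iff] at ho ⊢; omega

lemma cm_unique {mu la : Partn} (hle : ∀ i, mu.parts (i + 1) ≤ la.parts (i + 1)) (f : ℕ × ℕ → ℕ × ℕ)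
    (f1 : ∀ c, Sk mu la c → Sk mu la (f c)) (f2 : ∀ c, Sk mu la c → adjCell c (f c))
    (f3 : ∀ c, f (f c) = c)
    (f4 : ∀ i j, Sk mu la (i, j) → Sk mu la (i + 1, j) → f (i, j) = (i + 1, j)) :
    HDS mu la ∧ ∀ c, Sk mu la c → f c = cm mu la c := by
  have f4' : ∀ i j, Sk mu la (i, j) → Sk mu la (i + 1, j) → f (i + 1, j) = (i, j) := by
    intro i j h1 h2
    rw [← f4 i j h1 h2, f3]
  have h3 : ∀ i j, Sk mu la (i, j) → Sk mu la (i + 1, j) → ¬ Sk mu la (i + 2, j) := by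
    intro i j h1 h2 h3
    have e1 := f4' i j h1 h2
    have e2 := f4 (i + 1) j h2 h3
    rw [e1] at e2
    simp at e2
    omega
  -- single cells
  have hs : ∀ i j, loD mu la i < j → j ≤ hiD mu la i →
      f (i + 1, j) = if Odd (j - loD mu la i) then (i + 1, j + 1) else (i + 1, j - 1) := by
    intro i j
    induction j using Nat.strong_induction_on with
    | _ j ih =>
      intro hlo hhi
      obtain ⟨a, b, c⟩ := single_iff.1 ⟨hlo, hhi⟩
      have key : f (i + 1, j) = (i + 1, j + 1) ∨ (f (i + 1, j) = (i + 1, j - 1) ∧ 1 ≤ j) := by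
        have h1 := f1 _ a
        have h2 := f2 _ a
        generalize hg : f (i + 1, j) = g at *
        obtain ⟨u, v⟩ := g
        simp only [adjCell] at h2
        rcases h2 with ⟨rfl, rfl | h⟩ | ⟨rfl, rfl | h⟩
        · left; rfl
        · right; refine ⟨?_, by omega⟩; rw [← h]; rfl
        · exact absurd h1 b
        · have : u = i := by omega
          subst this
          exact absurd h1 c
      split_ifs with ho
      · rcases key with h | ⟨h, hj⟩
        · exact h
        exfalso
        have hS : Sk mu la (i + 1, j - 1) := by rw [← h]; exact f1 _ a
        have hb : f (i + 1, j - 1) = (i + 1, j) := by rw [← h, f3]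
        by_cases hj1 : j - 1 = loD mu la i
        · have h2 := mu.parts_antitone (show 1 ≤ i + 1 by omega) (show i + 1 ≤ i + 2 by omega)
          have hS2 : Sk mu la (i + 1 + 1, j - 1) := by
            unfold Sk at hS ⊢
            unfold loD at hj1
            simp only at *
            have : i + 1 + 1 = i + 2 := rfl
            rw [this]
            omega
          have := f4 _ _ hS hS2
          rw [this] at hb
          simp at hb
        · have := ih (j - 1) (by omega) (by omega) (by omega)
          rw [if_neg (by rw [Nat.odd_iff] at ho ⊢; omega), hb] at this
          simp at this
          omega
      · have h0 : loD mu la i < j - 1 := by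
          rw [Nat.odd_iff] at ho; omega
        have := ih (j - 1) (by omega) h0 (by omega)
        rw [if_pos (by rw [Nat.odd_iff] at ho ⊢; omega), Nat.sub_add_cancel (by omega)] at this
        rw [← this, f3]
  have hH : HDS mu la := by
    intro i
    have hlh : loD mu la i ≤ hiD mu la i := by
      have a1 := hle i
      have a2 := la.parts_antitone (show 1 ≤ i + 1 by omega) (show i + 1 ≤ i + 2 by omega)
      unfold loD hiD
      split_ifs with hi
      · subst hi; simp at *; omega
      · have a3 := mu.parts_antitone (show 1 ≤ i by omega) (show i ≤ i + 1 by omega)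
        have a4 := mu.parts_antitone (show 1 ≤ i + 1 by omega) (show i + 1 ≤ i + 2 by omega)
        have a5 := la.parts_antitone (show 1 ≤ i by omega) (show i ≤ i + 1 by omega)
        have : la.parts (i + 2) ≤ mu.parts i := by
          by_contra hc
          refine h3 i (mu.parts i + 1) ?_ ?_ ?_ <;> unfold Sk <;> simp only <;> omega
        omega
    refine ⟨hlh, ?_⟩
    by_contra hne
    rw [Nat.not_even_iff_odd] at hne
    have hlt : loD mu la i < hiD mu la i := by
      rw [Nat.odd_iff] at hne; omega
    have e := hs i (hiD mu la i) hlt le_rfl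
    rw [if_pos hne] at e
    obtain ⟨a, b, c⟩ := single_iff.1 ⟨hlt, le_rfl⟩
    have hS : Sk mu la (i + 1, hiD mu la i + 1) := by rw [← e]; exact f1 _ a
    have hS2 : Sk mu la (i, hiD mu la i + 1) := by
      unfold Sk at hS ⊢
      unfold hiD at *
      split_ifs at * with hi
      · subst hi; simp at hS
      · have a5 := la.parts_antitone (show 1 ≤ i by omega) (show i ≤ i + 1 by omega)
        simp only at *
        omega
    have e2 := f4' _ _ hS2 hS
    rw [← e, f3] at e2
    simp at e2
  refine ⟨hH, ?_⟩
  rintro ⟨i, j⟩ hc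
  obtain ⟨i, rfl⟩ : ∃ k, i = k + 1 := ⟨i - 1, by have := hc.1; simp only at this; omega⟩
  by_cases hb : Sk mu la (i + 1 + 1, j)
  · rw [cm_below hc hb, f4 _ _ hc hb]
  by_cases ha : Sk mu la (i, j)
  · rw [cm_above hH ha hc, f4' _ _ ha hc]
  obtain ⟨h1, h2⟩ := single_iff.2 ⟨hc, hb, ha⟩
  rw [hs i j h1 h2]
  split_ifs with ho
  · rw [cm_odd h1 h2 ho]
  · rw [cm_even h1 h2 ho]



lemma DomTab.ext' {l : Partn} {m0 : ℕ} {S T : DomTab l m0} (h : ∀ c, S.entry c = T.entry c)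
    (h2 : ∀ c, S.mate c = T.mate c) : S = T := by
  have e1 : S.entry = T.entry := funext h
  have e2 : S.mate = T.mate := funext h2
  cases S; cases T; simp_all

abbrev DT (l : Partn) (m0 N : ℕ) (w : ℕ → ℕ) : Type :=
  {T : DomTab l m0 // ∀ k, 1 ≤ k → lab l T.entry k = if k ≤ N then 2 * w k else 0}

lemma DomTab.tiled_of_pos {l : Partn} {m0 : ℕ} (T : DomTab l m0) {c : ℕ × ℕ} (h : 1 ≤ T.entry c) :
    l.tiled m0 c := by
  by_contra hc
  have := T.entry_zero c hc
  omega

lemma DomTab.out {l : Partn} {m0 : ℕ} (T : DomTab l m0) {c : ℕ × ℕ} (h : ¬ l.cell c) :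
    T.entry c = 0 ∧ T.mate c = c :=
  ⟨T.entry_zero c (fun h' => h h'.1), T.mate_id c (fun h' => h h'.1)⟩

lemma DomTab.mate_cell {l : Partn} {m0 : ℕ} (T : DomTab l m0) {c : ℕ × ℕ} (h : l.cell c) :
    l.cell (T.mate c) := by
  by_cases ht : l.tiled m0 c
  · exact (T.mate_tiled c ht).1
  · rwa [T.mate_id c ht]

lemma DomTab.col_le {l : Partn} {m0 : ℕ} (T : DomTab l m0) {i j : ℕ} (hi : 1 ≤ i) (h : l.cell (i + 1, j)) :
    T.entry (i, j) ≤ T.entry (i + 1, j) := by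
  by_cases hm : T.mate (i, j) = (i + 1, j)
  · rw [← hm, T.mate_entry]
  · exact (T.col_strict i j hi h hm).le

lemma DT.le {l : Partn} {m0 N : ℕ} {w : ℕ → ℕ} (T : DT l m0 N w) (c : ℕ × ℕ) : T.1.entry c ≤ N := by
  by_cases hc : l.cell c
  · apply le_of_lab (fun k hk => ?_) c hc
    rw [T.2 k (by omega), if_neg (by omega)]
  · rw [(T.1.out hc).1]; omega

instance (l : Partn) (m0 N : ℕ) (w : ℕ → ℕ) : Finite (DT l m0 N w) := by
  apply Finite.of_injective (β := (cellsF l) → Fin (N + 1) × (cellsF l))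
    (fun T c => (⟨T.1.entry c.1, by have := T.le c.1; omega⟩,
      ⟨T.1.mate c.1, mem_cellsF.2 (T.1.mate_cell (mem_cellsF.1 c.2))⟩))
  intro S T h
  apply Subtype.ext
  have key : ∀ c, S.1.entry c = T.1.entry c ∧ S.1.mate c = T.1.mate c := by
    intro c
    by_cases hc : l.cell c
    · have := congrFun h ⟨c, mem_cellsF.2 hc⟩
      simpa using this
    · rw [(S.1.out hc).1, (S.1.out hc).2, (T.1.out hc).1, (T.1.out hc).2]
      simp
  exact DomTab.ext' (fun c => (key c).1) (fun c => (key c).2)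

lemma restr_mate {la mu : Partn} {m0 N : ℕ} (T : DomTab la m0)
    (h : ∀ c, mu.cell c ↔ la.cell c ∧ T.entry c ≤ N) {c : ℕ × ℕ} (hc : mu.cell c) :
    mu.cell (T.mate c) := by
  rw [h] at hc ⊢
  rw [T.mate_entry]
  exact ⟨T.mate_cell hc.1, hc.2⟩

def DomTab.restr {la mu : Partn} {m0 : ℕ} (N : ℕ) (T : DomTab la m0)
    (h : ∀ c, mu.cell c ↔ la.cell c ∧ T.entry c ≤ N) : DomTab mu m0 where
  m0_le := by
    rcases Nat.eq_zero_or_pos m0 with h0 | h0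
    · omega
    · have : mu.cell (1, m0) := by
        rw [h]
        refine ⟨⟨le_rfl, h0, T.m0_le⟩, ?_⟩
        rw [T.entry_zero _ (by simp [Partn.tiled])]
        omega
      exact this.2.2
  entry c := if mu.cell c then T.entry c else 0
  mate c := if mu.cell c then T.mate c else c
  entry_pos c hc := by rw [if_pos hc.1]; exact T.entry_pos c ⟨((h c).1 hc.1).1, hc.2⟩
  entry_zero c hc := by
    split_ifs with h1
    · exact T.entry_zero c (fun h2 => hc ⟨h1, h2.2⟩)
    · rfl
  mate_tiled c hc := by
    rw [if_pos hc.1]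
    exact ⟨restr_mate T h hc.1, (T.mate_tiled c ⟨((h c).1 hc.1).1, hc.2⟩).2⟩
  mate_id c hc := by
    split_ifs with h1
    · exact T.mate_id c (fun h2 => hc ⟨h1, h2.2⟩)
    · rfl
  mate_invol c := by
    by_cases h1 : mu.cell c
    · rw [if_pos h1, if_pos (restr_mate T h h1), T.mate_invol]
    · rw [if_neg h1, if_neg h1]
  mate_adj c hc := by
    rw [if_pos hc.1]
    exact T.mate_adj c ⟨((h c).1 hc.1).1, hc.2⟩
  mate_entry c := by
    by_cases h1 : mu.cell c
    · rw [if_pos h1, if_pos (restr_mate T h h1), if_pos h1, T.mate_entry]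
    · rw [if_neg h1, if_neg h1]
  row_weak i j hc := by
    rw [if_pos hc]
    split_ifs
    · exact T.row_weak i j ((h _).1 hc).1
    · omega
  col_strict i j hi hc := by
    have hc' := cell_up hc hi
    rw [if_pos hc, if_pos hc', if_pos hc']
    exact T.col_strict i j hi ((h _).1 hc).1

lemma HDS.cell {mu la : Partn} (h : HDS mu la) {c : ℕ × ℕ} (hc : mu.cell c) : la.cell c := by
  obtain ⟨h1, h2, h3⟩ := hc
  have := h.le (c.1 - 1)
  rw [Nat.sub_add_cancel h1] at this
  exact ⟨h1, h2, h3.trans this⟩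

lemma Sk_tiled {mu la : Partn} {m0 : ℕ} (hm : m0 ≤ mu.parts 1) {c : ℕ × ℕ} (h : Sk mu la c) :
    la.tiled m0 c := by
  refine ⟨(Sk_iff.1 h).1, ?_⟩
  rintro ⟨h1, h2⟩
  have := h.2.1
  rw [h1] at this
  omega

lemma cm_not {mu la : Partn} {c : ℕ × ℕ} (h : ¬ Sk mu la c) : cm mu la c = c := by
  rw [cm, if_neg h]

def DomTab.extd {la mu : Partn} {m0 : ℕ} (N : ℕ) (U : DomTab mu m0) (hN : ∀ c, U.entry c ≤ N)
    (h : HDS mu la) : DomTab la m0 where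
  m0_le := U.m0_le.trans (h.le 0)
  entry c := if mu.cell c then U.entry c else if la.cell c then N + 1 else 0
  mate c := if mu.cell c then U.mate c else cm mu la c
  entry_pos c hc := by
    by_cases h1 : mu.cell c
    · rw [if_pos h1]
      exact U.entry_pos c ⟨h1, hc.2⟩
    · rw [if_neg h1, if_pos hc.1]
      omega
  entry_zero c hc := by
    by_cases h1 : mu.cell c
    · rw [if_pos h1]
      exact U.entry_zero c (fun h2 => hc ⟨h.cell h1, h2.2⟩)
    · rw [if_neg h1, if_neg]
      intro h2
      exact hc (Sk_tiled U.m0_le (Sk_iff.2 ⟨h2, h1⟩))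
  mate_tiled c hc := by
    by_cases h1 : mu.cell c
    · rw [if_pos h1]
      have := U.mate_tiled c ⟨h1, hc.2⟩
      exact ⟨h.cell this.1, this.2⟩
    · rw [if_neg h1]
      exact Sk_tiled U.m0_le (cm_spec h (Sk_iff.2 ⟨hc.1, h1⟩)).1
  mate_id c hc := by
    by_cases h1 : mu.cell c
    · rw [if_pos h1]
      exact U.mate_id c (fun h2 => hc ⟨h.cell h1, h2.2⟩)
    · rw [if_neg h1]
      exact cm_not (fun h2 => hc (Sk_tiled U.m0_le h2))
  mate_invol c := by
    by_cases h1 : mu.cell c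
    · rw [if_pos h1, if_pos (U.mate_cell h1), U.mate_invol]
    · rw [if_neg h1]
      by_cases h2 : Sk mu la c
      · obtain ⟨a, b, d⟩ := cm_spec h h2
        rw [if_neg (Sk_iff.1 a).2, d]
      · rw [cm_not h2, if_neg h1, cm_not h2]
  mate_adj c hc := by
    by_cases h1 : mu.cell c
    · rw [if_pos h1]
      exact U.mate_adj c ⟨h1, hc.2⟩
    · rw [if_neg h1]
      exact (cm_spec h (Sk_iff.2 ⟨hc.1, h1⟩)).2.1
  mate_entry c := by
    by_cases h1 : mu.cell c
    · rw [if_pos h1, if_pos (U.mate_cell h1), if_pos h1, U.mate_entry]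
    · rw [if_neg h1]
      by_cases h2 : Sk mu la c
      · obtain ⟨a, b, d⟩ := cm_spec h h2
        rw [if_neg (Sk_iff.1 a).2, if_pos (Sk_iff.1 a).1, if_neg h1, if_pos (Sk_iff.1 h2).1]
      · rw [cm_not h2]
  row_weak i j hc := by
    by_cases h1 : mu.cell (i, j + 1)
    · rw [if_pos h1]
      split_ifs with h2 h3
      · exact U.row_weak i j h1
      · exact absurd (cell_left h1 h3.2.1) h2
      · omega
    · rw [if_neg h1, if_pos hc]
      have := hN (i, j)
      split_ifs <;> omega
  col_strict i j hi hc hm := by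
    have hc' := cell_up hc hi
    by_cases h1 : mu.cell (i + 1, j)
    · have h2 := cell_up h1 hi
      rw [if_pos h2] at hm
      rw [if_pos h1, if_pos h2]
      exact U.col_strict i j hi h1 hm
    · rw [if_neg h1, if_pos hc]
      by_cases h2 : mu.cell (i, j)
      · rw [if_pos h2]
        have := hN (i, j)
        omega
      · rw [if_neg h2] at hm
        exact absurd (cm_below (Sk_iff.2 ⟨hc', h2⟩) (Sk_iff.2 ⟨hc, h1⟩)) hm

lemma DT_unique {la mu : Partn} {m0 N : ℕ} {w : ℕ → ℕ} (T : DT la m0 (N + 1) w)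
    (h : ∀ c, mu.cell c ↔ la.cell c ∧ T.1.entry c ≤ N) :
    HDS mu la ∧ ∀ c, Sk mu la c → T.1.mate c = cm mu la c := by
  have hN : ∀ c, Sk mu la c → T.1.entry c = N + 1 := by
    intro c hc
    rw [Sk_iff, h] at hc
    have := T.le c
    have : ¬ T.1.entry c ≤ N := fun h' => hc.2 ⟨hc.1, h'⟩
    omega
  apply cm_unique
  · exact parts_le_of_cell (fun c hc => ((h c).1 hc).1)
  · intro c hc
    have h1 := hN c hc
    rw [Sk_iff] at hc ⊢
    refine ⟨T.1.mate_cell hc.1, ?_⟩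
    rw [h, T.1.mate_entry]
    omega
  · intro c hc
    exact T.1.mate_adj c (T.1.tiled_of_pos (by rw [hN c hc]; omega))
  · exact T.1.mate_invol
  · intro i j h1 h2
    by_contra hm
    have := T.1.col_strict i j h1.1 (Sk_iff.1 h2).1 hm
    rw [hN _ h1, hN _ h2] at this
    omega

lemma card_DT_succ (la : Partn) (m0 N : ℕ) (w : ℕ → ℕ) :
    Nat.card (DT la m0 (N + 1) w) =
      ∑ mu ∈ (bF la.size).filter (fun mu => HDS mu la ∧ la.size = mu.size + 2 * w (N + 1)),
        Nat.card (DT mu m0 N w) := by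
  rw [card_fiber ((bF la.size).filter (fun mu => HDS mu la ∧ la.size = mu.size + 2 * w (N + 1)))
    (fun (T : DT la m0 (N + 1) w) mu => ∀ c, mu.cell c ↔ la.cell c ∧ T.1.entry c ≤ N)]
  · apply Finset.sum_congr rfl
    intro mu hmu
    rw [Finset.mem_filter, mem_bF] at hmu
    obtain ⟨-, hHS, hsz⟩ := hmu
    have aux : ∀ (U : DT mu m0 N w) c, mu.cell c ↔ la.cell c ∧ (U.1.extd N U.le hHS).entry c ≤ N := by
      intro U c
      simp only [DomTab.extd]
      constructor
      · intro hc
        rw [if_pos hc]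
        exact ⟨hHS.cell hc, U.le c⟩
      · rintro ⟨a, b⟩
        by_contra hc
        rw [if_neg hc, if_pos a] at b
        omega
    refine Nat.card_congr ⟨fun T => ⟨T.1.1.restr N T.2, ?_⟩, fun U => ⟨⟨U.1.extd N U.le hHS, ?_⟩, aux U⟩, ?_, ?_⟩
    · intro k hk
      split_ifs with hkN
      · rw [lab_congr T.2 (fun c hc => by simp [DomTab.restr, hc]) k hkN, T.1.2 k hk, if_pos (by omega)]
      · apply lab_zero (N := N) _ k (by omega)
        intro c hc
        simp only [DomTab.restr, hc, if_true]
        exact ((T.2 c).1 hc).2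
    · intro k hk
      have hb : ∀ c, la.cell c → (U.1.extd N U.le hHS).entry c ≤ N + 1 := by
        intro c hc
        simp only [DomTab.extd]
        have := U.le c
        split_ifs <;> omega
      rcases Nat.lt_trichotomy k (N + 1) with hkN | rfl | hkN
      · rw [← lab_congr (e' := U.1.entry) (aux U) (fun c hc => by simp [DomTab.extd, hc]) k (by omega), U.2 k hk,
          if_pos (by omega), if_pos (by omega)]
      · have := size_lab (aux U) hb
        rw [if_pos le_rfl]
        omega
      · rw [if_neg (by omega)]
        exact lab_zero hb k hkN
    · intro T
      apply Subtype.ext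
      apply Subtype.ext
      apply DomTab.ext'
      · intro c
        simp only [DomTab.restr, DomTab.extd]
        by_cases hc : mu.cell c
        · simp [hc]
        · simp only [hc, if_false]
          by_cases hl : la.cell c
          · have h1 := T.1.le c
            have h2 : ¬ T.1.1.entry c ≤ N := fun h => hc ((T.2 c).2 ⟨hl, h⟩)
            simp only [hl, if_true]
            omega
          · simp only [hl, if_false]
            rw [(T.1.1.out hl).1]
      · intro c
        simp only [DomTab.restr, DomTab.extd]
        by_cases hc : mu.cell c
        · simp [hc]
        · simp only [hc, if_false]
          by_cases hl : la.cell c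
          · exact ((DT_unique T.1 T.2).2 c (Sk_iff.2 ⟨hl, hc⟩)).symm
          · rw [(T.1.1.out hl).2, cm_not]
            exact fun h => hl (Sk_iff.1 h).1
    · intro U
      apply Subtype.ext
      apply DomTab.ext'
      · intro c
        simp only [DomTab.restr, DomTab.extd]
        by_cases hc : mu.cell c
        · simp [hc]
        · simp only [hc, if_false]
          rw [(U.1.out hc).1]
      · intro c
        simp only [DomTab.restr, DomTab.extd]
        by_cases hc : mu.cell c
        · simp [hc]
        · simp only [hc, if_false]
          rw [(U.1.out hc).2]
  · intro T
    obtain ⟨mu, hmu⟩ := exists_sub la (fun c => la.cell c ∧ T.1.entry c ≤ N) (fun c hc => hc.1)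
      (fun i j hj hc => ⟨cell_left hc.1 hj, (T.1.row_weak i j hc.1).trans hc.2⟩)
      (fun i j hi hc => ⟨cell_up hc.1 hi, (T.1.col_le hi hc.1).trans hc.2⟩)
    refine ⟨mu, ?_, hmu⟩
    have hH := (DT_unique T hmu).1
    rw [Finset.mem_filter, mem_bF]
    refine ⟨hH.size_le, hH, ?_⟩
    have := size_lab hmu (fun c _ => T.le c)
    rwa [T.2 (N + 1) (by omega), if_pos le_rfl] at this
  · intro T mu nu h1 h2
    exact eq_of_cell fun c => (h1 c).trans (h2 c).symm

lemma card_DT_zero (la : Partn) (m0 : ℕ) (w : ℕ → ℕ) :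
    Nat.card (DT la m0 0 w) = if la = Partn.ofRow m0 then 1 else 0 := by
  have hrow : ∀ c, (Partn.ofRow m0).cell c ↔ c.1 = 1 ∧ 1 ≤ c.2 ∧ c.2 ≤ m0 := by
    intro c
    unfold Partn.cell Partn.ofRow
    simp only
    split_ifs <;> omega
  split_ifs with h
  · subst h
    have ht : ∀ c, ¬ (Partn.ofRow m0).tiled m0 c := by
      rintro c ⟨h1, h2⟩
      rw [hrow] at h1
      exact h2 ⟨h1.1, h1.2.2⟩
    rw [Nat.card_eq_one_iff_unique]
    constructor
    · constructor
      intro S T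
      apply Subtype.ext
      apply DomTab.ext'
      · intro c
        rw [S.1.entry_zero c (ht c), T.1.entry_zero c (ht c)]
      · intro c
        rw [S.1.mate_id c (ht c), T.1.mate_id c (ht c)]
    · refine ⟨⟨⟨by simp [Partn.ofRow], fun _ => 0, id, fun c h => absurd h (ht c), fun _ _ => rfl,
        fun c h => absurd h (ht c), fun _ _ => rfl, fun _ => rfl, fun c h => absurd h (ht c), fun _ => rfl,
        fun i j h => le_rfl, fun i j hi h => ?_⟩, ?_⟩⟩
      · rw [hrow] at h
        simp only at h
        omega
      · intro k hk
        rw [if_neg (by omega)]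
        exact lab_zero (N := 0) (by simp) k (by omega)
  · rw [Nat.card_eq_zero]
    left
    constructor
    intro T
    apply h
    apply eq_of_cell
    intro c
    rw [hrow]
    constructor
    · intro hc
      by_contra hh
      have := T.1.entry_pos c ⟨hc, fun h' => hh ⟨h'.1, hc.2.1, h'.2⟩⟩
      have := T.le c
      omega
    · rintro ⟨h1, h2, h3⟩
      refine ⟨by omega, h2, ?_⟩
      rw [h1]
      exact h3.trans T.1.m0_le

lemma lab_even {la : Partn} {m0 : ℕ} (T : DomTab la m0) (k : ℕ) (hk : 1 ≤ k) : Even (lab la T.entry k) := by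
  rw [← ZMod.natCast_eq_zero_iff_even, lab, Finset.card_eq_sum_ones, Nat.cast_sum]
  apply Finset.sum_involution (fun c _ => T.mate c)
  · intro c hc; rfl
  · intro c hc _ he
    rw [Finset.mem_filter] at hc
    have := T.mate_adj c (T.tiled_of_pos (by omega))
    rw [he] at this
    simp [adjCell] at this
  · intro c hc
    rw [Finset.mem_filter, mem_cellsF] at hc ⊢
    rw [T.mate_entry]
    exact ⟨T.mate_cell hc.1, hc.2⟩
  · intro c hc
    exact T.mate_invol c

lemma wt_lab {la : Partn} {m0 : ℕ} (T : DomTab la m0) (k : ℕ) (hk : 1 ≤ k) :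
    lab la T.entry k = 2 * T.wt k := by
  have h : {c : ℕ × ℕ | la.tiled m0 c ∧ T.entry c = k} = {c : ℕ × ℕ | la.cell c ∧ T.entry c = k} := by
    ext c
    constructor
    · rintro ⟨a, b⟩; exact ⟨a.1, b⟩
    · rintro ⟨a, b⟩; exact ⟨T.tiled_of_pos (by omega), b⟩
  rw [DomTab.wt, h, lab_eq_ncard]
  obtain ⟨r, hr⟩ := lab_even T k hk
  omega

lemma card_wt (la : Partn) (m0 N : ℕ) (w : ℕ → ℕ) :
    Nat.card {T : DomTab la m0 // ∀ k, 1 ≤ k → T.wt k = if k ≤ N then w k else 0} =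
      Nat.card (DT la m0 N w) := by
  apply Nat.card_congr
  apply Equiv.subtypeEquivRight
  intro T
  apply forall_congr'
  intro k
  apply forall_congr'
  intro hk
  rw [wt_lab T k hk]
  split_ifs <;> omega

lemma nstat_ofRow (m : ℕ) : (Partn.ofRow m).nstat = 0 := by
  unfold Partn.nstat
  rw [show (fun i => (i - 1) * (Partn.ofRow m).parts i) = fun _ => 0 from ?_]
  · simp
  · ext i
    simp only [Partn.ofRow]
    split_ifs with h
    · subst h; simp
    · simp

lemma main (m : ℕ → ℕ) (ell : ℕ) :
    sSchur (Partn.ofRow (m 0)) *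
        ∏ r ∈ Finset.Icc 1 ell, ∑ i ∈ Finset.range (2 * m r + 1),
          ((-1 : ℂ) ^ i) • (sSchur (Partn.ofRow i) * sSchur (Partn.ofRow (2 * m r - i))) =
      ∑ la ∈ (bF (m 0 + 2 * ∑ r ∈ Finset.Icc 1 ell, m r)).filter
          (fun la => la.size = m 0 + 2 * ∑ r ∈ Finset.Icc 1 ell, m r),
        (((-1 : ℂ) ^ la.nstat) * (Nat.card (DT la (m 0) ell m) : ℂ)) • sSchur la := by
  induction ell with
  | zero =>
    simp only [card_DT_zero]
    rw [Finset.sum_eq_single (Partn.ofRow (m 0))]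
    · simp [nstat_ofRow]
    · intro b _ hb
      simp [hb]
    · intro h
      exfalso
      apply h
      rw [Finset.mem_filter, mem_bF, size_ofRow]
      simp
  | succ ell ih =>
    rw [Finset.prod_Icc_succ_top (by omega), Finset.sum_Icc_succ_top (by omega), ← mul_assoc, ih, Finset.sum_mul]
    generalize ∑ r ∈ Finset.Icc 1 ell, m r = s
    rw [Finset.sum_congr rfl (fun mu _ => by rw [smul_mul_assoc, step, Finset.smul_sum])]
    rw [Finset.sum_comm' (t' := (bF (m 0 + 2 * (s + m (ell + 1)))).filter
          (fun la => la.size = m 0 + 2 * (s + m (ell + 1))))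
      (s' := fun la => (bF la.size).filter (fun mu => HDS mu la ∧ la.size = mu.size + 2 * m (ell + 1)))]
    · apply Finset.sum_congr rfl
      intro la hla
      rw [card_DT_succ, Nat.cast_sum, Finset.mul_sum, Finset.sum_smul]
      apply Finset.sum_congr rfl
      intro mu hmu
      rw [smul_smul]
      congr 1
      rw [pow_add]
      have : (-1 : ℂ) ^ mu.nstat * (-1) ^ mu.nstat = 1 := by
        rw [← mul_pow]; simp
      linear_combination ((-1 : ℂ) ^ la.nstat * (Nat.card (DT mu (m 0) ell m) : ℂ)) * this
    · intro mu la
      simp only [Finset.mem_filter, mem_bF]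
      constructor
      · rintro ⟨⟨a, b⟩, c, d, e⟩
        exact ⟨⟨d.size_le, d, e⟩, by omega, by omega⟩
      · rintro ⟨⟨a, b, c⟩, d, e⟩
        exact ⟨⟨by omega, by omega⟩, by omega, b, c⟩


/-- Lemma `PieriLemma` (b).  For nonnegative integers
`(m_0, m_1, …, m_ℓ)` summing to `n`,
`s_{(m_0)} ∏_{r=1}^ℓ ∑_{i=0}^{2m_r} (-1)^i s_{(i)} s_{(2m_r - i)}
  = ∑_{λ ⊢ 2n - m_0} (-1)^{n(λ)} |D^λ| s_λ`,
where `|D^λ|` is the number of domino tableaux of shape `λ/(m_0)` and weight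
`(m_0, m_1, …, m_ℓ)`. -/
theorem pieri_domino (ell : ℕ) (m : ℕ → ℕ) (n : ℕ)
    (hsum : ∑ r ∈ Finset.range (ell + 1), m r = n) :
    sSchur (Partn.ofRow (m 0)) *
        ∏ r ∈ Finset.Icc 1 ell, ∑ i ∈ Finset.range (2 * m r + 1),
          ((-1 : ℂ) ^ i) • (sSchur (Partn.ofRow i) * sSchur (Partn.ofRow (2 * m r - i))) =
      ∑ᶠ lam : Partn, if lam.size = 2 * n - m 0 then
        (((-1 : ℂ) ^ lam.nstat) *
          (Nat.card {T : DomTab lam (m 0) //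
            ∀ k, 1 ≤ k → T.wt k = if k ≤ ell then m k else 0} : ℂ)) • sSchur lam
      else 0 := by
  have hs : 2 * n - m 0 = m 0 + 2 * ∑ r ∈ Finset.Icc 1 ell, m r := by
    have : ∑ r ∈ Finset.range (ell + 1), m r = m 0 + ∑ r ∈ Finset.Icc 1 ell, m r := by
      clear hsum
      induction ell with
      | zero => simp
      | succ e ih => rw [Finset.sum_range_succ, ih, Finset.sum_Icc_succ_top (by omega), add_assoc]
    omega
  rw [main, hs]
  generalize m 0 + 2 * ∑ r ∈ Finset.Icc 1 ell, m r = s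
  rw [finsum_eq_sum_of_support_subset (s := bF s)]
  · rw [Finset.sum_filter]
    apply Finset.sum_congr rfl
    intro la _
    rw [card_wt]
  · intro la hla
    rw [Function.mem_support] at hla
    rw [Finset.mem_coe, mem_bF]
    by_contra hc
    exact hla (if_neg (by omega))

end GGU
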